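/- arXiv:1304.7965 — 8 statements merged into one kernel-verified Lean document; each statement's English description precedes it below -/
import Mathlib

section
/- Let D_1, …, D_m ⊆ ℝ^n be nonempty closed convex sets with D := ⋂_{i=1}^m D_i nonempty, let x_0 ∈ ℝ^n, and let (x_k) be the sequence of cyclic projections onto D_1, …, D_m starting at x_0. Suppose Hölderian regularity with exponent τ ∈ (0, 1] holds: for every compact set K ⊆ ℝ^n and every θ > 0 there exists c_0 > 0 such that dist(x, D)^θ ≤ c_0·( Σ_{i=1}^m dist(x, D_i)^θ )^τ for all x ∈ K. Then (x_k) converges to some x_∞ ∈ D, and there exist M > 0 and r_0 ∈ (0, 1) such that for all k ≥ 1: if τ ∈ (0, 1) then ‖x_k − x_∞‖ ≤ M·k^{−1/(2τ^{−1} − 2)}, and if τ = 1 then ‖x_k − x_∞‖ ≤ M·r_0^k. -/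
open Metric Set Filter
open scoped BigOperators

noncomputable section

/-- Obtuse-angle form of the nearest-point inequality for a convex set. -/
lemma dist_sq_add_dist_sq_le_of_nearest {E : Type*} [NormedAddCommGroup E]
    [InnerProductSpace ℝ E] {K : Set E} (hK : Convex ℝ K) {u w z : E} (hw : w ∈ K)
    (hmin : ∀ y ∈ K, dist u w ≤ dist u y) (hz : z ∈ K) :
    dist u w ^ 2 + dist w z ^ 2 ≤ dist u z ^ 2 := by
  have hinf : ‖u - w‖ = ⨅ y : K, ‖u - y‖ := by
    have : Nonempty K := ⟨⟨w, hw⟩⟩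
    apply le_antisymm
    · refine le_ciInf fun y => ?_
      simpa only [dist_eq_norm] using hmin y y.2
    · exact ciInf_le ⟨0, by rintro _ ⟨y, rfl⟩; exact norm_nonneg _⟩ (⟨w, hw⟩ : K)
  have h := (norm_eq_iInf_iff_real_inner_le_zero hK hw).1 hinf z hz
  have h2 := norm_sub_sq_real (u - w) (z - w)
  rw [sub_sub_sub_cancel_right] at h2
  rw [dist_eq_norm, dist_comm w z, dist_eq_norm, dist_eq_norm, h2]
  linarith

/-- A recursion `b (k + m) ≤ b k - c * b k ^ (1 + s)` forces the decay `b k ^ s = O(1 / k)`. -/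
lemma exists_rpow_mul_le_one_of_sub_rpow {b : ℕ → ℝ} (hb : ∀ k, 0 ≤ b k) (hanti : Antitone b)
    {m : ℕ} (hm : 0 < m) {c s : ℝ} (hc : 0 < c) (hs : 0 < s)
    (hstep : ∀ k, c * b k ^ (1 + s) ≤ b k - b (k + m)) :
    ∃ ε > 0, ∀ k : ℕ, b k ^ s * (ε * k) ≤ 1 := by
  have hu : ∀ k, 0 ≤ b k ^ s := fun k => Real.rpow_nonneg (hb k) s
  have hcontr : ∀ k, b (k + m) ^ s * (1 + s * c * b k ^ s) ≤ b k ^ s := by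
    intro k
    have h1 : b (k + m) ≤ b k * Real.exp (-(c * b k ^ s)) := by
      have h2 := hstep k
      rw [Real.rpow_one_add' (hb k) (by positivity)] at h2
      have h3 := mul_le_mul_of_nonneg_left (Real.add_one_le_exp (-(c * b k ^ s))) (hb k)
      linarith
    have h4 := Real.rpow_le_rpow (hb _) h1 hs.le
    rw [Real.mul_rpow (hb k) (Real.exp_pos _).le, ← Real.exp_mul] at h4
    calc b (k + m) ^ s * (1 + s * c * b k ^ s)
        ≤ b (k + m) ^ s * Real.exp (s * c * b k ^ s) := by
          gcongr
          · exact hu _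
          · linarith [Real.add_one_le_exp (s * c * b k ^ s)]
      _ ≤ b k ^ s * Real.exp (-(c * b k ^ s) * s) * Real.exp (s * c * b k ^ s) := by gcongr
      _ = b k ^ s := by
          rw [mul_assoc, ← Real.exp_add]
          ring_nf
          simp
  set a := min (s * c) (1 / (1 + b 0 ^ s))
  have h0 : 0 < 1 + b 0 ^ s := by linarith [hu 0]
  have hapos : 0 < a := lt_min (by positivity) (by positivity)
  have hcycle : ∀ j : ℕ, b (m * j) ^ s * (a * (j + 1)) ≤ 1 := by
    intro j
    induction j with
    | zero =>
      have h1 : a * (1 + b 0 ^ s) ≤ 1 := by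
        rw [← le_div_iff₀ h0]; exact min_le_right _ _
      simp only [mul_zero, Nat.cast_zero, zero_add, mul_one]
      linarith
    | succ j ih =>
      have h1 := hcontr (m * j)
      have hu0 := hu (m * j)
      have hw0 := hu (m * j + m)
      rw [Nat.mul_succ]
      push_cast
      generalize b (m * j) ^ s = u at *
      generalize b (m * j + m) ^ s = w at *
      have h2 : w * (1 + a * u) ≤ u := by
        refine le_trans ?_ h1
        gcongr
        exact min_le_left _ _
      rcases hu0.eq_or_lt with rfl | hupos
      · have : w = 0 := by linarith
        simp [this]
      · have h3 : w * (a * (j + 1 + 1)) * u ≤ 1 * u := by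
          have := mul_le_mul_of_nonneg_left ih hw0
          nlinarith
        exact le_of_mul_le_mul_right h3 hupos
  refine ⟨a / m, by positivity, fun k => ?_⟩
  have hk : (k : ℝ) ≤ m * ((k / m : ℕ) + 1) := by
    exact_mod_cast (Nat.lt_mul_div_succ k hm).le
  have hm' : (0 : ℝ) < m := by exact_mod_cast hm
  have hak : a / m * k ≤ a * ((k / m : ℕ) + 1) := by
    rw [div_mul_eq_mul_div, div_le_iff₀ hm']
    nlinarith
  refine le_trans ?_ (hcycle (k / m))
  exact mul_le_mul (Real.rpow_le_rpow (hb k) (hanti (Nat.mul_div_le k m)) hs.le) hak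
    (by positivity) (hu _)

/-- An antitone sequence contracting by a fixed factor every `m` steps decays geometrically. -/
lemma le_geometric_of_contraction {b : ℕ → ℝ} (hb : ∀ k, 0 ≤ b k) (hanti : Antitone b)
    {m : ℕ} (hm : 0 < m) {r : ℝ} (hr0 : 0 < r) (hr1 : r < 1)
    (hstep : ∀ k, b (k + m) ≤ r ^ m * b k) (k : ℕ) :
    b k ≤ b 0 / r ^ m * r ^ k := by
  induction k using Nat.strong_induction_on with
  | _ k ih =>
    rcases lt_or_ge k m with hkm | hkm
    · rw [div_mul_eq_mul_div, le_div_iff₀ (by positivity)]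
      exact mul_le_mul (hanti (Nat.zero_le k)) (pow_le_pow_of_le_one hr0.le hr1.le hkm.le)
        (by positivity) (hb 0)
    · obtain ⟨l, rfl⟩ := Nat.exists_eq_add_of_le' hkm
      calc b (l + m) ≤ r ^ m * b l := hstep l
        _ ≤ r ^ m * (b 0 / r ^ m * r ^ l) := by gcongr; exact ih l (by omega)
        _ = b 0 / r ^ m * r ^ (l + m) := by ring

/-- Consecutive steps control the distance to every set visited within one cycle. -/
lemma dist_sq_le_mul_sum_dist_sq {E : Type*} [PseudoMetricSpace E] (x : ℕ → E) (k : ℕ)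
    {j m : ℕ} (hj : j ≤ m) :
    dist (x k) (x (k + j)) ^ 2 ≤ m * ∑ l ∈ Finset.range m, dist (x (k + l)) (x (k + l + 1)) ^ 2 := by
  have h1 : dist (x k) (x (k + j)) ≤ ∑ l ∈ Finset.range m, dist (x (k + l)) (x (k + l + 1)) :=
    (dist_le_range_sum_dist (fun l => x (k + l)) j).trans
      (Finset.sum_le_sum_of_subset_of_nonneg (Finset.range_mono hj) fun _ _ _ => dist_nonneg)
  calc _ ≤ (∑ l ∈ Finset.range m, dist (x (k + l)) (x (k + l + 1))) ^ 2 := by gcongr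
    _ ≤ _ := by simpa using sq_sum_le_card_mul_sum_sq (s := Finset.range m)
                  (f := fun l => dist (x (k + l)) (x (k + l + 1)))

/-- Convergence rate of the cyclic projection algorithm under Hölderian regularity
(Proposition 4.2). -/
theorem cyclic_projection_rate_of_holderian_regularity
    (n m : ℕ) (hm : 0 < m)
    (D : Fin m → Set (EuclideanSpace ℝ (Fin n)))
    (hDne : ∀ i, (D i).Nonempty) (hDcl : ∀ i, IsClosed (D i))
    (hDcv : ∀ i, Convex ℝ (D i))
    (hne : (⋂ i, D i).Nonempty)
    -- the sequence of cyclic projections: `x (k+1)` is the nearest point of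
    -- `D (k % m)` to `x k`
    (x : ℕ → EuclideanSpace ℝ (Fin n))
    (hx : ∀ k : ℕ, x (k + 1) ∈ D ⟨k % m, Nat.mod_lt k hm⟩ ∧
      ∀ y ∈ D ⟨k % m, Nat.mod_lt k hm⟩, dist (x k) (x (k + 1)) ≤ dist (x k) y)
    (τ : ℝ) (hτ0 : 0 < τ) (hτ1 : τ ≤ 1)
    (hreg : ∀ K : Set (EuclideanSpace ℝ (Fin n)), IsCompact K → ∀ θ : ℝ, 0 < θ →
      ∃ c₀ > (0 : ℝ), ∀ y ∈ K,
        Metric.infDist y (⋂ i, D i) ^ θ ≤ c₀ * (∑ i, Metric.infDist y (D i) ^ θ) ^ τ) :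
    ∃ xinf ∈ ⋂ i, D i, Tendsto x atTop (nhds xinf) ∧
      ∃ M > (0 : ℝ), ∃ r₀ ∈ Set.Ioo (0 : ℝ) 1, ∀ k : ℕ, 1 ≤ k →
        (τ < 1 → ‖x k - xinf‖ ≤ M * (k : ℝ) ^ (-(1 / (2 * τ⁻¹ - 2)))) ∧
        (τ = 1 → ‖x k - xinf‖ ≤ M * r₀ ^ k) := by
  set C := ⋂ i, D i
  have hCcl : IsClosed C := isClosed_iInter hDcl
  have hsq : ∀ k, ∀ z ∈ C,
      dist (x k) (x (k + 1)) ^ 2 + dist (x (k + 1)) z ^ 2 ≤ dist (x k) z ^ 2 := fun k z hz =>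
    dist_sq_add_dist_sq_le_of_nearest (hDcv _) (hx k).1 (hx k).2 (mem_iInter.1 hz _)
  have hfejer : ∀ z ∈ C, Antitone fun k => dist (x k) z := fun z hz =>
    antitone_nat_of_succ_le fun k =>
      le_of_sq_le_sq (by linarith [hsq k z hz, sq_nonneg (dist (x k) (x (k + 1)))]) dist_nonneg
  have hproj : ∀ k, ∃ z ∈ C, infDist (x k) C = dist (x k) z := fun k =>
    hCcl.exists_infDist_eq_dist hne (x k)
  set b : ℕ → ℝ := fun k => infDist (x k) C
  have hb : ∀ k, 0 ≤ b k := fun k => infDist_nonneg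
  have hanti : Antitone b := by
    intro k l hkl
    obtain ⟨z, hz, hzk⟩ := hproj k
    exact (infDist_le_dist_of_mem hz).trans ((hfejer z hz hkl).trans hzk.ge)
  have hsum : ∀ k N, ∀ z ∈ C, ∑ l ∈ Finset.range N, dist (x (k + l)) (x (k + l + 1)) ^ 2
      + dist (x (k + N)) z ^ 2 ≤ dist (x k) z ^ 2 := by
    intro k N z hz
    induction N with
    | zero => simp
    | succ N ih =>
      rw [Finset.sum_range_succ]
      have := hsq (k + N) z hz
      rw [← add_assoc]
      linarith
  have hdist : ∀ k i, infDist (x k) (D i) ^ 2 ≤ m * (b k ^ 2 - b (k + m) ^ 2) := by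
    intro k i
    obtain ⟨z, hz, hzk⟩ := hproj k
    obtain ⟨j, hjm, hj⟩ : ∃ j ≤ m, x (k + j) ∈ D i := by
      refine ⟨(i + (m - k % m)) % m + 1, Nat.mod_lt _ hm, ?_⟩
      have h := (hx (k + (i + (m - k % m)) % m)).1
      have hmod : (k + (i + (m - k % m)) % m) % m = i := by
        have h1 : k % m ≤ m := (Nat.mod_lt k hm).le
        rw [Nat.add_mod_mod, ← Nat.mod_add_mod,
          show k % m + (i + (m - k % m)) = i + m by omega, Nat.add_mod_right,
          Nat.mod_eq_of_lt i.2]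
      simp only [hmod] at h
      exact h
    calc infDist (x k) (D i) ^ 2 ≤ dist (x k) (x (k + j)) ^ 2 := by
          gcongr
          · exact infDist_nonneg
          · exact infDist_le_dist_of_mem hj
      _ ≤ _ := dist_sq_le_mul_sum_dist_sq x k hjm
      _ ≤ m * (b k ^ 2 - b (k + m) ^ 2) := by
          gcongr
          have h1 := hsum k m z hz
          have h2 : b (k + m) ^ 2 ≤ dist (x (k + m)) z ^ 2 := by
            gcongr
            · exact hb _
            · exact infDist_le_dist_of_mem hz
          have h3 : b k = dist (x k) z := hzk
          rw [h3]
          linarith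
  obtain ⟨c, hc, hrec⟩ : ∃ c > 0, ∀ k, c * (b k ^ 2) ^ τ⁻¹ ≤ b k ^ 2 - b (k + m) ^ 2 := by
    obtain ⟨z, hz⟩ := hne
    obtain ⟨c₀, hc₀, hcK⟩ := hreg (closedBall z (dist (x 0) z)) (isCompact_closedBall _ _) 2 two_pos
    have hm' : (0 : ℝ) < m := by exact_mod_cast hm
    refine ⟨1 / (c₀ ^ τ⁻¹ * (m * m)), by positivity, fun k => ?_⟩
    have hgap : 0 ≤ b k ^ 2 - b (k + m) ^ 2 :=
      sub_nonneg.2 (pow_le_pow_left₀ (hb _) (hanti (Nat.le_add_right k m)) 2)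
    have h1 := hcK (x k) (hfejer z hz (Nat.zero_le k))
    simp only [Real.rpow_two] at h1
    have h2 : ∑ i, infDist (x k) (D i) ^ 2 ≤ m * m * (b k ^ 2 - b (k + m) ^ 2) := by
      refine (Finset.sum_le_sum fun i _ => hdist k i).trans_eq ?_
      simp
      ring
    have h3 : b k ^ 2 ≤ c₀ * (m * m * (b k ^ 2 - b (k + m) ^ 2)) ^ τ := by
      refine h1.trans ?_
      gcongr
    have h4 := Real.rpow_le_rpow (sq_nonneg _) h3 (inv_nonneg.2 hτ0.le)
    rw [Real.mul_rpow hc₀.le (by positivity), ← Real.rpow_mul (by positivity),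
      mul_inv_cancel₀ hτ0.ne', Real.rpow_one] at h4
    rw [one_div, inv_mul_le_iff₀ (by positivity)]
    linarith
  have hdiam : ∀ k l, k ≤ l → dist (x k) (x l) ≤ 2 * b k := by
    intro k l hkl
    obtain ⟨z, hz, hzk⟩ := hproj k
    have h1 := dist_triangle_right (x k) (x l) z
    have h2 : dist (x l) z ≤ dist (x k) z := hfejer z hz hkl
    have h3 : b k = dist (x k) z := hzk
    linarith
  -- Any rate for the distance to the intersection transfers to the iterates.
  obtain ⟨M, hM, r₀, hr₀, hrate⟩ : ∃ M > (0 : ℝ), ∃ r₀ ∈ Set.Ioo (0 : ℝ) 1, ∀ k : ℕ, 1 ≤ k →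
      (τ < 1 → b k ≤ M * (k : ℝ) ^ (-(1 / (2 * τ⁻¹ - 2)))) ∧ (τ = 1 → b k ≤ M * r₀ ^ k) := by
    rcases hτ1.lt_or_eq with hτ | rfl
    · have hs : 0 < τ⁻¹ - 1 := sub_pos.2 ((one_lt_inv₀ hτ0).2 hτ)
      obtain ⟨ε, hε, hdecay⟩ := exists_rpow_mul_le_one_of_sub_rpow (b := fun k => b k ^ 2)
        (fun k => sq_nonneg _) (fun k l hkl => pow_le_pow_left₀ (hb l) (hanti hkl) 2) hm hc hs
        (fun k => by simpa using hrec k)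
      have hp : 0 < 2 * τ⁻¹ - 2 := by linarith
      refine ⟨ε ^ (-(1 / (2 * τ⁻¹ - 2))), by positivity, 1 / 2, by norm_num, fun k hk =>
        ⟨fun _ => ?_, fun h => absurd h hτ.ne⟩⟩
      have hk' : (0 : ℝ) < k := by exact_mod_cast hk
      have h1 : (b k ^ 2) ^ (τ⁻¹ - 1) ≤ (ε * k)⁻¹ := by
        rw [← one_div (ε * k), le_div_iff₀ (by positivity)]
        exact hdecay k
      rw [← Real.rpow_two, ← Real.rpow_mul (hb k), mul_sub, mul_one] at h1
      rw [← Real.mul_rpow hε.le hk'.le, Real.rpow_neg (by positivity),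
        ← Real.inv_rpow (by positivity)]
      have h2 := Real.rpow_le_rpow (Real.rpow_nonneg (hb k) _) h1 (one_div_pos.2 hp).le
      rwa [← Real.rpow_mul (hb k), mul_one_div_cancel hp.ne', Real.rpow_one] at h2
    · set q := max (1 - c) (1 / 2) with hq
      have hq0 : 0 < q := lt_max_of_lt_right (by norm_num)
      have hq1 : q < 1 := max_lt (by linarith) (by norm_num)
      have hm' : (0 : ℝ) < m := by exact_mod_cast hm
      set r := q ^ (1 / (2 * m : ℝ)) with hr
      have hr0 : 0 < r := Real.rpow_pos_of_pos hq0 _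
      have hr1 : r < 1 := Real.rpow_lt_one hq0.le hq1 (by positivity)
      have hrq : (r ^ m) ^ 2 = q := by
        rw [← pow_mul, hr, ← Real.rpow_natCast, ← Real.rpow_mul hq0.le]
        push_cast
        rw [show 1 / (2 * m : ℝ) * (m * 2) = 1 by field_simp, Real.rpow_one]
      have hcontr : ∀ k, b (k + m) ≤ r ^ m * b k := by
        intro k
        refine le_of_sq_le_sq ?_ (mul_nonneg (by positivity) (hb k))
        rw [mul_pow, hrq]
        have h1 := hrec k
        rw [inv_one, Real.rpow_one] at h1
        have h2 := mul_le_mul_of_nonneg_right (le_max_left (1 - c) (1 / 2)) (sq_nonneg (b k))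
        rw [← hq] at h2
        linarith
      refine ⟨(b 0 + 1) / r ^ m, div_pos (by linarith [hb 0]) (by positivity), r, ⟨hr0, hr1⟩,
        fun k _ => ⟨fun h => absurd h (lt_irrefl _), fun _ => ?_⟩⟩
      refine (le_geometric_of_contraction hb hanti hm hr0 hr1 hcontr k).trans ?_
      gcongr
      linarith
  have hb0 : Tendsto b atTop (nhds 0) := by
    rcases hτ1.lt_or_eq with hτ | hτ
    · have hp : 0 < 1 / (2 * τ⁻¹ - 2) :=
        one_div_pos.2 (by linarith [(one_lt_inv₀ hτ0).2 hτ])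
      refine squeeze_zero' (.of_forall hb)
        ((eventually_ge_atTop 1).mono fun k hk => (hrate k hk).1 hτ) ?_
      simpa using ((tendsto_rpow_neg_atTop hp).comp tendsto_natCast_atTop_atTop).const_mul M
    · refine squeeze_zero' (.of_forall hb)
        ((eventually_ge_atTop 1).mono fun k hk => (hrate k hk).2 hτ) ?_
      simpa using (tendsto_pow_atTop_nhds_zero_of_lt_one hr₀.1.le hr₀.2).const_mul M
  have hcauchy : CauchySeq x :=
    cauchySeq_of_le_tendsto_0' (fun k => 2 * b k) hdiam (by simpa using hb0.const_mul 2)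
  obtain ⟨y, hy⟩ := cauchySeq_tendsto_of_complete hcauchy
  have hyC : y ∈ C := by
    rw [hCcl.mem_iff_infDist_zero hne]
    exact tendsto_nhds_unique (((continuous_infDist_pt C).tendsto y).comp hy) hb0
  have hlim : ∀ k, ‖x k - y‖ ≤ 2 * b k := fun k => by
    rw [← dist_eq_norm]
    exact le_of_tendsto (tendsto_const_nhds.dist hy)
      ((eventually_ge_atTop k).mono fun l hl => hdiam k l hl)
  refine ⟨y, hyC, hy, 2 * M, by positivity, r₀, hr₀, fun k hk => ⟨fun h => ?_, fun h => ?_⟩⟩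
  · linarith [hlim k, (hrate k hk).1 h]
  · linarith [hlim k, (hrate k hk).2 h]
end
end

section
/- Let n, m, l, d be positive integers, let g_1, …, g_m and h_1, …, h_l be convex polynomials on ℝ^n of degree at most d, and set A := {x ∈ ℝ^n : g_i(x) ≤ 0, i = 1, …, m} and B := {x ∈ ℝ^n : h_j(x) ≤ 0, j = 1, …, l}. Assume A ∩ B is nonempty. Let b_0 ∈ ℝ^n and define the alternating projection sequences a_{k+1} := P_A(b_k) and b_{k+1} := P_B(a_{k+1}) for k ≥ 0. Then both (a_k) and (b_k) converge to a common point c ∈ A ∩ B, and there exist M > 0 and r_0 ∈ (0, 1) such that for all k ≥ 1: if d > 1 then ‖a_k − c‖ ≤ M·k^{−ρ} and ‖b_k − c‖ ≤ M·k^{−ρ}, and if d = 1 then ‖a_k − c‖ ≤ M·r_0^k and ‖b_k − c‖ ≤ M·r_0^k, where ρ := 1/min{(2d−1)^n − 1, 2·β(n−1)·d^n − 2}. -/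
open Metric Set Filter
open scoped BigOperators

noncomputable section

/-- A function whose restriction to every line is a polynomial of degree at most `d`. -/
def IsPolyOnLines {V : Type*} [AddCommGroup V] [Module ℝ V] (d : ℕ) (f : V → ℝ) : Prop :=
  ∀ x v : V, ∃ p : Polynomial ℝ, p.natDegree ≤ d ∧ ∀ t : ℝ, f (x + t • v) = p.eval t

/-- A nonnegative convex function vanishing at the origin, whose zero set is stable under scaling
and which grows along rays at most like the `d`-th power. -/
structure IsFacial {V : Type*} [AddCommGroup V] [Module ℝ V] (d : ℕ) (F : V → ℝ) : Prop where
  convexOn : ConvexOn ℝ Set.univ F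
  nonneg : ∀ x, 0 ≤ F x
  zero : F 0 = 0
  smul_eq_zero : ∀ x, F x = 0 → ∀ t : ℝ, F (t • x) = 0
  growth : ∃ K : ℝ, 0 < K ∧ ∀ v, ∀ t : ℝ, 0 < t → t ≤ 1 → F v * t ^ d ≤ K * F (t • v)

/-- Polynomials of degree at most `d` bounded on the unit interval grow at most like `s ^ d`. -/
theorem exists_polynomial_growth_bound (d : ℕ) :
    ∃ K : ℝ, 0 < K ∧ ∀ q : Polynomial ℝ, q.natDegree ≤ d → ∀ m : ℝ,
      (∀ s : ℝ, 0 ≤ s → s ≤ 1 → |q.eval s| ≤ m) → ∀ s : ℝ, 1 ≤ s → |q.eval s| ≤ K * m * s ^ d := by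
  classical
  set v : ℕ → ℝ := fun j => (j : ℝ) / (d + 1) with hv
  have hvinj : Function.Injective v := by
    intro a b hab
    have : (0 : ℝ) < d + 1 := by positivity
    simp only [hv] at hab
    field_simp at hab
    exact_mod_cast hab
  have hv0 : ∀ j, 0 ≤ v j := fun j => by positivity
  have hv1 : ∀ j ∈ Finset.range (d + 1), v j ≤ 1 := by
    intro j hj
    have : (j : ℝ) ≤ d + 1 := by
      have := Finset.mem_range.1 hj
      exact_mod_cast this.le
    simp only [hv]
    exact (div_le_one (by positivity)).2 this
  set K : ℝ := ∑ j ∈ Finset.range (d + 1),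
    ∏ i ∈ (Finset.range (d + 1)).erase j, |(v j - v i)⁻¹| with hK
  have hK0 : 0 ≤ K := Finset.sum_nonneg fun j _ => Finset.prod_nonneg fun i _ => abs_nonneg _
  refine ⟨K + 1, by positivity, fun q hq m hm s hs => ?_⟩
  have hm0 : 0 ≤ m := (abs_nonneg _).trans (hm 0 le_rfl zero_le_one)
  have hint := Lagrange.eq_interpolate (s := Finset.range (d + 1)) (v := v) (f := q)
    hvinj.injOn (by
      rw [Finset.card_range]
      exact lt_of_le_of_lt Polynomial.degree_le_natDegree (by exact_mod_cast Nat.lt_succ_of_le hq))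
  have heval : q.eval s = ∑ j ∈ Finset.range (d + 1), q.eval (v j) *
      ∏ i ∈ (Finset.range (d + 1)).erase j, ((v j - v i)⁻¹ * (s - v i)) := by
    conv_lhs => rw [hint]
    simp [Lagrange.interpolate_apply, Polynomial.eval_finsetSum, Lagrange.basis,
      Polynomial.eval_prod, Lagrange.basisDivisor]
  have hbound : |q.eval s| ≤ K * m * s ^ d := by
    rw [heval, hK, Finset.sum_mul, Finset.sum_mul]
    refine (Finset.abs_sum_le_sum_abs _ _).trans (Finset.sum_le_sum fun j hj => ?_)
    rw [abs_mul, Finset.abs_prod]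
    simp_rw [abs_mul]
    rw [Finset.prod_mul_distrib]
    have h1 : ∏ i ∈ (Finset.range (d + 1)).erase j, |s - v i| ≤ s ^ d := by
      have : ∏ i ∈ (Finset.range (d + 1)).erase j, |s - v i| ≤
          ∏ _i ∈ (Finset.range (d + 1)).erase j, s := by
        refine Finset.prod_le_prod (fun i _ => abs_nonneg _) fun i hi => ?_
        have := hv1 i (Finset.mem_of_mem_erase hi)
        have := hv0 i
        rw [abs_le]
        constructor <;> linarith
      simpa [Finset.card_erase_of_mem hj] using this
    have h2 := hm (v j) (hv0 j) (hv1 j hj)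
    have h3 : 0 ≤ ∏ i ∈ (Finset.range (d + 1)).erase j, |(v j - v i)⁻¹| :=
      Finset.prod_nonneg fun i _ => abs_nonneg _
    calc _ ≤ m * ((∏ i ∈ (Finset.range (d + 1)).erase j, |(v j - v i)⁻¹|) * s ^ d) := by
          gcongr
      _ = _ := by ring
  have : 0 ≤ m * s ^ d := by positivity
  nlinarith

namespace IsPolyOnLines

variable {V : Type*} [AddCommGroup V] [Module ℝ V] {d : ℕ}

theorem comp_linearMap {W : Type*} [AddCommGroup W] [Module ℝ W] {f : V → ℝ}
    (hf : IsPolyOnLines d f) (φ : W →ₗ[ℝ] V) : IsPolyOnLines d (fun w => f (φ w)) := by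
  intro x v
  obtain ⟨p, hp, h⟩ := hf (φ x) (φ v)
  exact ⟨p, hp, fun t => by simp [← h]⟩

theorem comp_const_add {f : V → ℝ} (hf : IsPolyOnLines d f) (c : V) :
    IsPolyOnLines d (fun x => f (c + x)) := by
  intro x v
  obtain ⟨p, hp, h⟩ := hf (c + x) v
  exact ⟨p, hp, fun t => by simp [← h, add_assoc]⟩

theorem sum_mul {κ : Type*} [Fintype κ] {f : κ → V → ℝ} (hf : ∀ i, IsPolyOnLines d (f i))
    (c : κ → ℝ) : IsPolyOnLines d (fun x => ∑ i, c i * f i x) := by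
  intro x v
  choose p hp h using fun i => hf i x v
  refine ⟨∑ i, Polynomial.C (c i) * p i, ?_, fun t => ?_⟩
  · exact Polynomial.natDegree_sum_le_of_forall_le _ _ fun i _ =>
      (Polynomial.natDegree_C_mul_le _ _).trans (hp i)
  · simp [Polynomial.eval_finsetSum, h]

/-- A nonnegative convex function which is polynomial on lines and vanishes at `0` is facial. -/
theorem isFacial {F : V → ℝ} (hF : IsPolyOnLines d F) (hconv : ConvexOn ℝ Set.univ F)
    (hnonneg : ∀ x, 0 ≤ F x) (hzero : F 0 = 0) : IsFacial d F := by
  have hshrink : ∀ x, ∀ s : ℝ, 0 ≤ s → s ≤ 1 → F (s • x) ≤ s * F x := by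
    intro x s hs0 hs1
    have := hconv.2 (mem_univ x) (mem_univ 0) hs0 (sub_nonneg.2 hs1) (by ring)
    simpa [hzero] using this
  refine ⟨hconv, hnonneg, hzero, fun x hx t => ?_, ?_⟩
  · obtain ⟨p, -, hp⟩ := hF 0 x
    have hp0 : p = 0 := by
      apply Polynomial.eq_zero_of_infinite_isRoot
      refine (Set.Icc_infinite (zero_lt_one (α := ℝ))).mono fun s hs => ?_
      have h1 := hshrink x s hs.1 hs.2
      have h2 := hnonneg (s • x)
      have h3 := hp s
      rw [zero_add] at h3
      simp only [Set.mem_ofPred_eq, Polynomial.IsRoot.def]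
      rw [← h3]
      rw [hx] at h1
      linarith
    have := hp t
    simpa [hp0] using this
  · obtain ⟨K, hK0, hK⟩ := exists_polynomial_growth_bound d
    refine ⟨K, hK0, fun v t ht0 ht1 => ?_⟩
    obtain ⟨p, hpd, hp⟩ := hF 0 (t • v)
    simp only [zero_add] at hp
    have hb := hK p hpd (F (t • v)) (fun s hs0 hs1 => by
      rw [← hp, abs_of_nonneg (hnonneg _)]
      have := hshrink (t • v) s hs0 hs1
      nlinarith [hnonneg (t • v)]) t⁻¹ ((one_le_inv₀ ht0).2 ht1)
    rw [← hp, abs_of_nonneg (hnonneg _), smul_smul, inv_mul_cancel₀ ht0.ne', one_smul] at hb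
    calc F v * t ^ d ≤ (K * F (t • v) * t⁻¹ ^ d) * t ^ d := by gcongr
      _ = K * F (t • v) := by
        rw [mul_assoc, ← mul_pow, inv_mul_cancel₀ ht0.ne', one_pow, mul_one]

end IsPolyOnLines

/-- Fan-Glicksberg-Hoffman alternative for finite systems of strict convex inequalities. -/
theorem exists_multipliers_of_no_strict_solution {V κ : Type*} [AddCommGroup V] [Module ℝ V]
    [Fintype κ] {f : κ → V → ℝ} (hconv : ∀ i, ConvexOn ℝ Set.univ (f i))
    (hns : ¬ ∃ z, ∀ i, f i z < 0) :
    ∃ c : κ → ℝ, (∀ i, 0 ≤ c i) ∧ (∃ i, 0 < c i) ∧ ∀ x, 0 ≤ ∑ i, c i * f i x := by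
  classical
  set U : Set (κ → ℝ) := {u | ∃ x, ∀ i, f i x < u i} with hU
  have hUconv : Convex ℝ U := by
    rintro u ⟨x, hx⟩ w ⟨y, hy⟩ a b ha hb hab
    refine ⟨a • x + b • y, fun i => ?_⟩
    have h1 := (hconv i).2 (mem_univ x) (mem_univ y) ha hb hab
    have h2 := hx i
    have h3 := hy i
    simp only [smul_eq_mul, Pi.add_apply, Pi.smul_apply] at h1 ⊢
    rcases ha.eq_or_lt with rfl | ha'
    · have : b = 1 := by linarith
      subst this
      linarith
    · nlinarith
  have hUopen : IsOpen U := by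
    have : U = ⋃ x, ⋂ i, {u : κ → ℝ | f i x < u i} := by
      ext u; simp [hU]
    rw [this]
    exact isOpen_iUnion fun x => isOpen_iInter_of_finite fun i =>
      isOpen_lt continuous_const (continuous_apply i)
  have h0 : (0 : κ → ℝ) ∉ U := fun ⟨x, hx⟩ => hns ⟨x, hx⟩
  obtain ⟨φ, hφ⟩ := geometric_hahn_banach_point_open hUconv hUopen h0
  rw [map_zero] at hφ
  have hsum : ∀ u : κ → ℝ, φ u = ∑ i, φ (Pi.single i 1) * u i := by
    intro u
    conv_lhs => rw [← Finset.univ_sum_single u]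
    rw [map_sum]
    refine Finset.sum_congr rfl fun i _ => ?_
    have : (Pi.single i (u i) : κ → ℝ) = u i • Pi.single i 1 := by
      rw [← Pi.single_smul]; simp
    rw [this, map_smul, smul_eq_mul, mul_comm]
  have hc : ∀ i, 0 ≤ φ (Pi.single i 1) := by
    intro i
    by_contra! hneg
    set u₀ : κ → ℝ := fun i => f i 0 + 1
    have hpos := hφ u₀ ⟨0, fun i => by simp [u₀]⟩
    set s := φ u₀ / (-φ (Pi.single i 1)) with hs
    have hs0 : 0 ≤ s := div_nonneg hpos.le (by linarith)
    have hlt := hφ (u₀ + s • Pi.single i 1) ⟨0, fun j => by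
      have : (0 : ℝ) ≤ s * (Pi.single i (1 : ℝ) : κ → ℝ) j := by
        refine mul_nonneg hs0 ?_
        by_cases hij : j = i
        · subst hij; simp
        · simp [hij]
      simp only [u₀, Pi.add_apply, Pi.smul_apply, smul_eq_mul]
      linarith⟩
    rw [map_add, map_smul, smul_eq_mul, hs, div_mul_eq_mul_div, lt_iff_not_ge] at hlt
    apply hlt
    have : φ u₀ * φ (Pi.single i 1) / -φ (Pi.single i 1) = -φ u₀ := by
      have : φ (Pi.single i 1) ≠ 0 := hneg.ne
      field_simp
    linarith
  refine ⟨fun i => φ (Pi.single i 1), hc, ?_, fun x => ?_⟩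
  · by_contra! hle
    have hpos := hφ (fun i => f i 0 + 1) ⟨0, fun i => by simp⟩
    rw [hsum] at hpos
    refine hpos.not_ge (Finset.sum_nonpos fun i _ => ?_)
    simp [le_antisymm (hle i) (hc i)]
  · refine le_of_forall_pos_le_add fun ε hε => ?_
    set S := ∑ i, φ (Pi.single i 1) with hS
    have hS0 : 0 ≤ S := Finset.sum_nonneg fun i _ => hc i
    have hpos := hφ (fun i => f i x + ε / (S + 1)) ⟨x, fun i => by
      have : 0 < ε / (S + 1) := by positivity
      linarith⟩
    rw [hsum] at hpos
    simp_rw [mul_add] at hpos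
    rw [Finset.sum_add_distrib, ← Finset.sum_mul, ← hS] at hpos
    have : S * (ε / (S + 1)) ≤ ε := by
      rw [← mul_div_assoc, div_le_iff₀ (by positivity)]
      nlinarith
    linarith

theorem convexOn_sum_mul {V κ : Type*} [AddCommGroup V] [Module ℝ V] {s : Finset κ}
    {f : κ → V → ℝ} {c : κ → ℝ} (hconv : ∀ i ∈ s, ConvexOn ℝ Set.univ (f i))
    (hc : ∀ i ∈ s, 0 ≤ c i) : ConvexOn ℝ Set.univ (fun x => ∑ i ∈ s, c i * f i x) := by
  refine ⟨convex_univ, fun x _ y _ a b ha hb hab => ?_⟩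
  simp only [smul_eq_mul, Finset.mul_sum]
  rw [← Finset.sum_add_distrib]
  refine Finset.sum_le_sum fun i hi => ?_
  have := (hconv i hi).2 (mem_univ x) (mem_univ y) ha hb hab
  simp only [smul_eq_mul] at this
  nlinarith [hc i hi]

/-- The absolute value of a function that is both convex and concave and vanishes at `0`. -/
theorem isFacial_abs {V : Type*} [AddCommGroup V] [Module ℝ V] {d : ℕ} (hd : 0 < d) {f : V → ℝ}
    (hf : ConvexOn ℝ Set.univ f) (hf' : ConvexOn ℝ Set.univ (fun x => -f x)) (h0 : f 0 = 0) :
    IsFacial d (fun x => |f x|) := by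
  have hshrink : ∀ x, ∀ s : ℝ, 0 ≤ s → s ≤ 1 → f (s • x) = s * f x := by
    intro x s hs0 hs1
    have h1 := hf.2 (mem_univ x) (mem_univ 0) hs0 (sub_nonneg.2 hs1) (by ring)
    have h2 := hf'.2 (mem_univ x) (mem_univ 0) hs0 (sub_nonneg.2 hs1) (by ring)
    simp only [smul_zero, add_zero, h0, smul_eq_mul, mul_zero, neg_zero] at h1 h2
    linarith
  have hpos : ∀ x, ∀ s : ℝ, 0 ≤ s → f (s • x) = s * f x := by
    intro x s hs
    rcases le_total s 1 with hs1 | hs1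
    · exact hshrink x s hs hs1
    · have hs0 : 0 < s := by linarith
      have := hshrink (s • x) s⁻¹ (by positivity) (inv_le_one_of_one_le₀ hs1)
      rw [smul_smul, inv_mul_cancel₀ hs0.ne', one_smul] at this
      rw [this, mul_inv_cancel_left₀ hs0.ne']
  have hneg : ∀ x, f (-x) = -f x := by
    intro x
    have h1 := hf.2 (mem_univ x) (mem_univ (-x))
      (by norm_num : (0 : ℝ) ≤ 1 / 2) (by norm_num : (0 : ℝ) ≤ 1 / 2) (by norm_num)
    have h2 := hf'.2 (mem_univ x) (mem_univ (-x))
      (by norm_num : (0 : ℝ) ≤ 1 / 2) (by norm_num : (0 : ℝ) ≤ 1 / 2) (by norm_num)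
    simp only [smul_neg, add_neg_cancel, h0, smul_eq_mul] at h1 h2
    linarith
  refine ⟨?_, fun x => abs_nonneg _, by simp [h0], fun x hx t => ?_, 1, one_pos,
    fun v t ht0 ht1 => ?_⟩
  · exact hf.sup hf'
  · have hx : f x = 0 := abs_eq_zero.1 hx
    rcases le_total 0 t with ht | ht
    · simp [hpos x t ht, hx]
    · have := hpos (-x) (-t) (by linarith)
      rw [smul_neg, neg_smul, neg_neg, hneg, hx] at this
      simp [this]
  · simp only [hpos v t ht0.le, abs_mul, abs_of_pos ht0, one_mul]
    have : t ^ d ≤ t := pow_le_of_le_one ht0.le ht1 hd.ne'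
    nlinarith [abs_nonneg (f v)]

/-- If a system of convex inequalities has no strict solution, some nonzero facial function is
controlled by the residual of the system. -/
theorem exists_isFacial_le_residual {V κ : Type*} [AddCommGroup V] [Module ℝ V] [Fintype κ]
    {d : ℕ} (hd : 0 < d) {f : κ → V → ℝ} (hconv : ∀ i, ConvexOn ℝ Set.univ (f i))
    (hpoly : ∀ i, IsPolyOnLines d (f i)) (h0 : ∀ i, f i 0 ≤ 0) (hne : ∀ i, ∃ x, f i x ≠ 0)
    (hns : ¬ ∃ z, ∀ i, f i z < 0) :
    ∃ F : V → ℝ, IsFacial d F ∧ (∃ x, F x ≠ 0) ∧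
      ∃ C : ℝ, 0 < C ∧ ∀ x, ∀ ε : ℝ, 0 ≤ ε → (∀ i, f i x ≤ ε) → F x ≤ C * ε := by
  classical
  obtain ⟨c, hc, ⟨i₀, hi₀⟩, hnn⟩ := exists_multipliers_of_no_strict_solution hconv hns
  have hsum0 : ∑ i, c i * f i 0 = 0 :=
    le_antisymm (Finset.sum_nonpos fun i _ => mul_nonpos_of_nonneg_of_nonpos (hc i) (h0 i)) (hnn 0)
  by_cases hF : ∃ x, ∑ i, c i * f i x ≠ 0
  · refine ⟨fun x => ∑ i, c i * f i x, (IsPolyOnLines.sum_mul hpoly c).isFacial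
      (convexOn_sum_mul (fun i _ => hconv i) fun i _ => hc i) hnn hsum0, hF, ∑ i, c i, ?_, ?_⟩
    · exact Finset.sum_pos' (fun i _ => hc i) ⟨i₀, Finset.mem_univ _, hi₀⟩
    · intro x ε _ hx
      rw [Finset.sum_mul]
      exact Finset.sum_le_sum fun i _ => mul_le_mul_of_nonneg_left (hx i) (hc i)
  · push Not at hF
    have hrepr : ∀ x, -f i₀ x = ∑ i ∈ Finset.univ.erase i₀, c i / c i₀ * f i x := by
      intro x
      have h1 := hF x
      rw [← Finset.add_sum_erase _ _ (Finset.mem_univ i₀)] at h1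
      have h2 : ∑ i ∈ Finset.univ.erase i₀, c i / c i₀ * f i x
          = (∑ i ∈ Finset.univ.erase i₀, c i * f i x) / c i₀ := by
        rw [Finset.sum_div]
        exact Finset.sum_congr rfl fun i _ => by ring
      rw [h2, eq_div_iff hi₀.ne']
      linarith
    have hconc : ConvexOn ℝ Set.univ (fun x => -f i₀ x) := by
      simp_rw [hrepr]
      exact convexOn_sum_mul (fun i _ => hconv i) fun i _ => div_nonneg (hc i) hi₀.le
    have hz : f i₀ 0 = 0 := by
      have h1 := hrepr 0
      have h2 : ∑ i ∈ Finset.univ.erase i₀, c i / c i₀ * f i 0 ≤ 0 :=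
        Finset.sum_nonpos fun i _ =>
          mul_nonpos_of_nonneg_of_nonpos (div_nonneg (hc i) hi₀.le) (h0 i)
      have := h0 i₀
      linarith
    obtain ⟨x₁, hx₁⟩ := hne i₀
    have hC : 0 ≤ ∑ i ∈ Finset.univ.erase i₀, c i / c i₀ :=
      Finset.sum_nonneg fun i _ => div_nonneg (hc i) hi₀.le
    refine ⟨fun x => |f i₀ x|, isFacial_abs hd (hconv i₀) hconc hz, ⟨x₁, by simpa using hx₁⟩,
      (∑ i ∈ Finset.univ.erase i₀, c i / c i₀) + 1, by positivity, fun x ε hε hx => ?_⟩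
    have h1 : -f i₀ x ≤ (∑ i ∈ Finset.univ.erase i₀, c i / c i₀) * ε := by
      rw [hrepr, Finset.sum_mul]
      exact Finset.sum_le_sum fun i _ =>
        mul_le_mul_of_nonneg_left (hx i) (div_nonneg (hc i) hi₀.le)
    have h2 := hx i₀
    rw [abs_le]
    constructor <;> nlinarith

namespace IsFacial

/-- The zero set of a facial function is a linear subspace. -/
def zeroSubmodule {V : Type*} [AddCommGroup V] [Module ℝ V] {d : ℕ} {F : V → ℝ}
    (hF : IsFacial d F) : Submodule ℝ V where
  carrier := {x | F x = 0}
  zero_mem' := hF.zero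
  smul_mem' t x hx := hF.smul_eq_zero x hx t
  add_mem' := by
    intro x y hx hy
    have h := hF.convexOn.2 (mem_univ ((2 : ℝ) • x)) (mem_univ ((2 : ℝ) • y))
      (by norm_num : (0 : ℝ) ≤ 1 / 2) (by norm_num : (0 : ℝ) ≤ 1 / 2) (by norm_num)
    rw [hF.smul_eq_zero x hx, hF.smul_eq_zero y hy, smul_smul, smul_smul] at h
    norm_num at h
    exact le_antisymm h (hF.nonneg _)

theorem mem_zeroSubmodule {V : Type*} [AddCommGroup V] [Module ℝ V] {d : ℕ} {F : V → ℝ}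
    (hF : IsFacial d F) {x : V} : x ∈ hF.zeroSubmodule ↔ F x = 0 := Iff.rfl

variable {V : Type*} [NormedAddCommGroup V] [InnerProductSpace ℝ V] [FiniteDimensional ℝ V]

/-- On bounded sets, the distance to the zero set of a facial function is controlled by the
`d`-th root of the function. -/
theorem exists_dist_pow_le {d : ℕ} (hd : 0 < d) {F : V → ℝ} (hF : IsFacial d F) {R : ℝ}
    (hR : 0 ≤ R) :
    ∃ C : ℝ, 0 < C ∧ ∀ x, ‖x‖ ≤ R →
      ‖x - hF.zeroSubmodule.starProjection x‖ ^ d ≤ C * F x := by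
  set L := hF.zeroSubmodule with hL
  have hcont : Continuous F := hF.convexOn.locallyLipschitz.continuous
  have hcpt : IsCompact (sphere (0 : V) (R + 1) ∩ (Lᗮ : Set V)) :=
    (isCompact_sphere 0 (R + 1)).inter_right (Submodule.isClosed_orthogonal L)
  obtain ⟨m, hm0, hm⟩ := hcpt.exists_forall_le' hcont.continuousOn (a := 0) (by
    rintro w ⟨hw, hwL⟩
    refine lt_of_le_of_ne (hF.nonneg w) fun h => ?_
    have hwmem : w ∈ L := h.symm
    have : w = 0 := by
      have := Submodule.mem_inf.2 ⟨hwmem, hwL⟩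
      rwa [Submodule.inf_orthogonal_eq_bot, Submodule.mem_bot] at this
    rw [this] at hw
    simp at hw
    linarith)
  obtain ⟨K, hK0, hK⟩ := hF.growth
  refine ⟨(2 * (R + 1)) ^ d * K / m, by positivity, fun x hx => ?_⟩
  set y := L.starProjection x with hy
  set w := x - y with hw
  have hwL : w ∈ Lᗮ := Submodule.sub_starProjection_mem_orthogonal x
  have hyL : y ∈ L := Submodule.starProjection_apply_mem L x
  have hhalf : F ((1 / 2 : ℝ) • w) ≤ F x := by
    have h := hF.convexOn.2 (mem_univ x) (mem_univ (-y))
      (by norm_num : (0 : ℝ) ≤ 1 / 2) (by norm_num : (0 : ℝ) ≤ 1 / 2) (by norm_num)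
    have h0 : F (-y) = 0 := L.neg_mem hyL
    rw [h0, ← smul_add, ← sub_eq_add_neg, ← hw, smul_zero, add_zero, smul_eq_mul] at h
    have := hF.nonneg x
    linarith
  rcases eq_or_ne w 0 with h0 | h0
  · rw [h0, norm_zero, zero_pow hd.ne']
    have := hF.nonneg x
    positivity
  have hwpos : 0 < ‖w‖ := norm_pos_iff.2 h0
  have hwle : ‖w‖ ≤ R := by
    have h1 := Submodule.norm_sq_eq_add_norm_sq_starProjection x L
    rw [Submodule.starProjection_orthogonal_val] at h1
    have h2 : ‖w‖ ^ 2 ≤ ‖x‖ ^ 2 := by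
      rw [h1]
      have := sq_nonneg ‖L.starProjection x‖
      linarith
    exact (abs_le_of_sq_le_sq' h2 (norm_nonneg _)).2.trans hx
  have hg := hK (((R + 1) / ‖w‖) • w) (‖w‖ / (2 * (R + 1))) (by positivity) (by
    rw [div_le_one (by positivity)]; linarith)
  have hmv := hm (((R + 1) / ‖w‖) • w) ⟨by
    rw [mem_sphere_zero_iff_norm, norm_smul, Real.norm_eq_abs, abs_of_pos (by positivity),
      div_mul_cancel₀ _ hwpos.ne'], Lᗮ.smul_mem _ hwL⟩
  have hscal : (‖w‖ / (2 * (R + 1))) • ((R + 1) / ‖w‖) • w = (1 / 2 : ℝ) • w := by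
    rw [smul_smul]
    congr 1
    field_simp
  rw [hscal, div_pow] at hg
  have hpow : 0 < (2 * (R + 1)) ^ d := by positivity
  have h1 : m * (‖w‖ ^ d / (2 * (R + 1)) ^ d) ≤ K * F x :=
    calc _ ≤ F (((R + 1) / ‖w‖) • w) * (‖w‖ ^ d / (2 * (R + 1)) ^ d) := by gcongr
      _ ≤ _ := hg
      _ ≤ _ := by gcongr
  rw [div_mul_eq_mul_div, le_div_iff₀ hm0]
  rw [← mul_div_assoc, div_le_iff₀ hpow] at h1
  linarith

end IsFacial

/-- A convex function on a finite-dimensional space is Lipschitz on bounded sets. -/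
theorem ConvexOn.exists_lipschitz_closedBall {V : Type*} [NormedAddCommGroup V]
    [NormedSpace ℝ V] [FiniteDimensional ℝ V] {ι : Type*} [Fintype ι] {f : ι → V → ℝ}
    (hf : ∀ i, ConvexOn ℝ Set.univ (f i)) (R : ℝ) :
    ∃ K : ℝ, 0 < K ∧ ∀ i, ∀ x y : V, ‖x‖ ≤ R → ‖y‖ ≤ R → f i x ≤ f i y + K * ‖x - y‖ := by
  have h : ∀ i, ∃ K, LipschitzOnWith K (f i) (closedBall 0 R) := fun i =>
    ((hf i).locallyLipschitz.locallyLipschitzOn).exists_lipschitzOnWith_of_compact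
      (isCompact_closedBall 0 R)
  choose K hK using h
  refine ⟨∑ i, (K i : ℝ) + 1, by positivity, fun i x y hx hy => ?_⟩
  have h1 := (hK i).dist_le_mul x (by simpa using hx) y (by simpa using hy)
  rw [Real.dist_eq, dist_eq_norm] at h1
  have h2 : (K i : ℝ) ≤ ∑ i, (K i : ℝ) :=
    Finset.single_le_sum (f := fun i => (K i : ℝ)) (fun i _ => NNReal.coe_nonneg _)
      (Finset.mem_univ i)
  have h3 := (le_abs_self _).trans h1
  have := norm_nonneg (x - y)
  nlinarith

/-- Lipschitz error bound under a strict feasibility condition on the nontrivial constraints. -/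
theorem infDist_le_of_strict_solution {V : Type*} [NormedAddCommGroup V] [NormedSpace ℝ V]
    {ι : Type*} [Fintype ι] {f : ι → V → ℝ} (hconv : ∀ i, ConvexOn ℝ Set.univ (f i)) {z : V}
    (hz : ∀ i, (∃ x, f i x ≠ 0) → f i z < 0) :
    ∃ δ : ℝ, 0 < δ ∧ ∀ x, ∀ ε : ℝ, 0 ≤ ε → (∀ i, f i x ≤ ε) →
      infDist x {y | ∀ i, f i y ≤ 0} ≤ ε / δ * ‖x - z‖ := by
  classical
  obtain ⟨δ, hδ, hδz⟩ : ∃ δ : ℝ, 0 < δ ∧ ∀ i, (∃ x, f i x ≠ 0) → f i z ≤ -δ := by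
    set J := Finset.univ.filter fun i => ∃ x, f i x ≠ 0
    rcases J.eq_empty_or_nonempty with hJ | hJ
    · refine ⟨1, one_pos, fun i hi => ?_⟩
      have : i ∈ J := by simpa [J] using hi
      simp [hJ] at this
    · obtain ⟨j, hj, hmax⟩ := J.exists_max_image (fun i => f i z) hJ
      refine ⟨-f j z, neg_pos.2 (hz j (by simpa [J] using hj)), fun i hi => ?_⟩
      rw [neg_neg]
      exact hmax i (by simpa [J] using hi)
  refine ⟨δ, hδ, fun x ε hε hx => ?_⟩
  set t := ε / (ε + δ) with ht
  have ht0 : 0 ≤ t := by positivity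
  have ht1 : t ≤ 1 := (div_le_one (by positivity)).2 (by linarith)
  have hmem : (1 - t) • x + t • z ∈ {y | ∀ i, f i y ≤ 0} := by
    intro i
    by_cases hi : ∃ x, f i x ≠ 0
    · have h1 := (hconv i).2 (mem_univ x) (mem_univ z) (sub_nonneg.2 ht1) ht0 (by ring)
      simp only [smul_eq_mul] at h1
      have h2 : (1 - t) * f i x ≤ (1 - t) * ε :=
        mul_le_mul_of_nonneg_left (hx i) (sub_nonneg.2 ht1)
      have h3 : t * f i z ≤ t * (-δ) := mul_le_mul_of_nonneg_left (hδz i hi) ht0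
      have h4 : (1 - t) * ε + t * (-δ) = 0 := by
        rw [ht]
        field_simp
        ring
      linarith
    · push Not at hi
      exact (hi _).le
  refine (infDist_le_dist_of_mem hmem).trans ?_
  have : x - ((1 - t) • x + t • z) = t • (x - z) := by module
  rw [dist_eq_norm, this, norm_smul, Real.norm_eq_abs, abs_of_nonneg ht0]
  gcongr
  rw [ht]
  gcongr
  linarith

/-- Hölder error bound on bounded sets, with exponent `1 / d ^ k` in dimension `k`, for systems
of convex inequalities that are polynomial of degree at most `d` on lines. -/
theorem exists_infDist_pow_le_residual.{u} {ι : Type*} [Fintype ι] {d : ℕ} (hd : 0 < d) (k : ℕ) :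
    ∀ (V : Type u) [NormedAddCommGroup V] [InnerProductSpace ℝ V] [FiniteDimensional ℝ V],
      Module.finrank ℝ V ≤ k → ∀ f : ι → V → ℝ, (∀ i, ConvexOn ℝ Set.univ (f i)) →
      (∀ i, IsPolyOnLines d (f i)) → (∀ i, f i 0 ≤ 0) → ∀ R : ℝ, 0 ≤ R →
      ∃ C : ℝ, 0 < C ∧ ∀ x, ‖x‖ ≤ R → ∀ ε : ℝ, 0 ≤ ε → (∀ i, f i x ≤ ε) →
        infDist x {y | ∀ i, f i y ≤ 0} ^ d ^ k ≤ C * ε := by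
  classical
  induction k with
  | zero =>
    intro V _ _ _ hk f hconv hpoly h0 R hR
    refine ⟨1, one_pos, fun x hx ε hε hfx => ?_⟩
    have : Subsingleton V := Module.finrank_zero_iff.1 (Nat.le_zero.1 hk)
    have hx0 : x ∈ {y | ∀ i, f i y ≤ 0} := by
      rw [Subsingleton.elim x 0]; exact h0
    rw [infDist_zero_of_mem hx0]
    simpa using hε
  | succ k ih =>
    intro V _ _ _ hk f hconv hpoly h0 R hR
    set S : Set V := {y | ∀ i, f i y ≤ 0} with hS
    have h0S : (0 : V) ∈ S := h0
    have hbdd : ∀ x : V, infDist x S ≤ ‖x‖ := fun x => by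
      simpa using infDist_le_dist_of_mem (x := x) h0S
    set N := d ^ (k + 1) with hN
    have hN0 : 0 < N := by positivity
    suffices h : ∃ C : ℝ, 0 < C ∧ ∀ x, ‖x‖ ≤ R → ∀ ε : ℝ, 0 ≤ ε → ε ≤ 1 → (∀ i, f i x ≤ ε) →
        infDist x S ^ N ≤ C * ε by
      obtain ⟨C, hC, h⟩ := h
      refine ⟨C + R ^ N, by positivity, fun x hx ε hε hfx => ?_⟩
      have hRN : 0 ≤ R ^ N := by positivity
      rcases le_total ε 1 with hε1 | hε1
      · have := h x hx ε hε hε1 hfx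
        nlinarith
      · have : infDist x S ^ N ≤ R ^ N :=
          pow_le_pow_left₀ infDist_nonneg ((hbdd x).trans hx) N
        nlinarith
    by_cases hstrict : ∃ z, ∀ i, (∃ x, f i x ≠ 0) → f i z < 0
    · obtain ⟨z, hz⟩ := hstrict
      obtain ⟨δ, hδ, hδS⟩ := infDist_le_of_strict_solution hconv hz
      refine ⟨(R + ‖z‖) / δ * R ^ (N - 1) + 1, by positivity, fun x hx ε hε _ hfx => ?_⟩
      have h1 : infDist x S ≤ ε / δ * (R + ‖z‖) := by
        refine (hδS x ε hε hfx).trans ?_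
        gcongr
        exact (norm_sub_le _ _).trans (by gcongr)
      have h2 : infDist x S ^ (N - 1) ≤ R ^ (N - 1) :=
        pow_le_pow_left₀ infDist_nonneg ((hbdd x).trans hx) _
      calc infDist x S ^ N = infDist x S ^ (N - 1) * infDist x S := by
            rw [← pow_succ, Nat.sub_add_cancel hN0]
        _ ≤ R ^ (N - 1) * (ε / δ * (R + ‖z‖)) := by
            have := infDist_nonneg (x := x) (s := S)
            gcongr
        _ = (R + ‖z‖) / δ * R ^ (N - 1) * ε := by ring
        _ ≤ _ := by nlinarith
    · obtain ⟨F, hF, ⟨x₁, hx₁⟩, C₁, hC₁, hFle⟩ :=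
        exists_isFacial_le_residual (κ := {i // ∃ x, f i x ≠ 0}) hd (f := fun i => f i.1)
          (fun i => hconv i) (fun i => hpoly i) (fun i => h0 i) (fun i => i.2)
          (fun ⟨z, hz⟩ => hstrict ⟨z, fun i hi => hz ⟨i, hi⟩⟩)
      obtain ⟨C₂, hC₂, hdist⟩ := hF.exists_dist_pow_le hd hR
      set L := hF.zeroSubmodule with hL
      have hLtop : L ≠ ⊤ := fun h => hx₁ (hF.mem_zeroSubmodule.1 (hL ▸ h ▸ Submodule.mem_top))
      have hLrank : Module.finrank ℝ L ≤ k := by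
        have := Submodule.finrank_lt hLtop
        omega
      obtain ⟨C₃, hC₃, herr⟩ := ih L hLrank (fun i y => f i y)
        (fun i => (hconv i).comp_linearMap L.subtype)
        (fun i => (hpoly i).comp_linearMap L.subtype) h0 R hR
      obtain ⟨K, hK, hlip⟩ := ConvexOn.exists_lipschitz_closedBall hconv R
      refine ⟨2 ^ (N - 1) * ((C₂ * C₁) ^ d ^ k + C₃ ^ d * (2 ^ (d - 1) * (1 + K ^ d * (C₂ * C₁)))),
        by positivity, fun x hx ε hε hε1 hfx => ?_⟩
      set y := L.starProjection x with hy
      have hyL : y ∈ L := Submodule.starProjection_apply_mem L x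
      have hyR : ‖y‖ ≤ R := (L.norm_starProjection_apply_le x).trans hx
      set r := ‖x - y‖ with hr
      have hr0 : 0 ≤ r := norm_nonneg _
      have hrd : r ^ d ≤ C₂ * C₁ * ε := by
        have h1 := hdist x hx
        have h2 := hFle x ε hε fun i => hfx i
        calc r ^ d ≤ C₂ * F x := h1
          _ ≤ C₂ * (C₁ * ε) := by gcongr
          _ = _ := by ring
      have hres : ∀ i, f i y ≤ ε + K * r := fun i => by
        have h1 := hlip i y x hyR hx
        rw [norm_sub_rev] at h1
        have := hfx i
        linarith
      have hE := herr ⟨y, hyL⟩ hyR (ε + K * r) (by positivity) hres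
      set e := infDist (⟨y, hyL⟩ : L) {y : L | ∀ i, f i y ≤ 0} with he
      have he0 : 0 ≤ e := infDist_nonneg
      have htri : infDist x S ≤ r + e := by
        have h1 : infDist y S ≤ e := by
          have hne : {y : L | ∀ i, f i y ≤ 0}.Nonempty := ⟨0, h0⟩
          refine (le_infDist hne).2 fun w hw => ?_
          exact infDist_le_dist_of_mem (s := S) (y := (w : V)) hw
        have h2 := infDist_le_infDist_add_dist (s := S) (x := x) (y := y)
        rw [dist_eq_norm] at h2
        linarith
      have hpowle : ∀ j : ℕ, 0 < j → ε ^ j ≤ ε := fun j hj => pow_le_of_le_one hε hε1 hj.ne'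
      have hrN : r ^ N ≤ (C₂ * C₁) ^ d ^ k * ε := by
        calc r ^ N = (r ^ d) ^ d ^ k := by rw [← pow_mul, hN, pow_succ']
          _ ≤ (C₂ * C₁ * ε) ^ d ^ k := by gcongr
          _ = (C₂ * C₁) ^ d ^ k * ε ^ d ^ k := mul_pow _ _ _
          _ ≤ _ := by
            gcongr
            exact hpowle _ (by positivity)
      have heN : e ^ N ≤ C₃ ^ d * (2 ^ (d - 1) * (1 + K ^ d * (C₂ * C₁))) * ε := by
        calc e ^ N = (e ^ d ^ k) ^ d := by rw [← pow_mul, hN, pow_succ]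
          _ ≤ (C₃ * (ε + K * r)) ^ d := by gcongr
          _ = C₃ ^ d * (ε + K * r) ^ d := mul_pow _ _ _
          _ ≤ C₃ ^ d * (2 ^ (d - 1) * (ε ^ d + (K * r) ^ d)) := by
            gcongr
            exact add_pow_le hε (by positivity) d
          _ ≤ C₃ ^ d * (2 ^ (d - 1) * (ε + K ^ d * (C₂ * C₁ * ε))) := by
            rw [mul_pow]
            gcongr
            exact hpowle d hd
          _ = _ := by ring
      calc infDist x S ^ N ≤ (r + e) ^ N := pow_le_pow_left₀ infDist_nonneg htri N
        _ ≤ 2 ^ (N - 1) * (r ^ N + e ^ N) := add_pow_le hr0 he0 N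
        _ ≤ 2 ^ (N - 1) * ((C₂ * C₁) ^ d ^ k * ε +
            C₃ ^ d * (2 ^ (d - 1) * (1 + K ^ d * (C₂ * C₁))) * ε) := by gcongr
        _ = _ := by ring

/-- Hölder error bound on balls around a feasible point. -/
theorem exists_infDist_pow_le_residual_of_feasible {ι : Type*} [Fintype ι] {d : ℕ} (hd : 0 < d)
    {V : Type*} [NormedAddCommGroup V] [InnerProductSpace ℝ V] [FiniteDimensional ℝ V]
    {f : ι → V → ℝ} (hconv : ∀ i, ConvexOn ℝ Set.univ (f i)) (hpoly : ∀ i, IsPolyOnLines d (f i))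
    {x₀ : V} (h0 : ∀ i, f i x₀ ≤ 0) {R : ℝ} (hR : 0 ≤ R) :
    ∃ C : ℝ, 0 < C ∧ ∀ x, ‖x - x₀‖ ≤ R → ∀ ε : ℝ, 0 ≤ ε → (∀ i, f i x ≤ ε) →
      infDist x {y | ∀ i, f i y ≤ 0} ^ d ^ Module.finrank ℝ V ≤ C * ε := by
  obtain ⟨C, hC, h⟩ := exists_infDist_pow_le_residual hd (Module.finrank ℝ V) V le_rfl
    (fun i x => f i (x₀ + x)) (fun i => by simpa [Function.comp_def] using (hconv i).translate_right x₀)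
    (fun i => (hpoly i).comp_const_add x₀) (fun i => by simpa using h0 i) R hR
  refine ⟨C, hC, fun x hx ε hε hfx => ?_⟩
  refine le_trans (pow_le_pow_left₀ infDist_nonneg ?_ _)
    (h (x - x₀) hx ε hε fun i => by simpa using hfx i)
  have hne : {y | ∀ i, f i (x₀ + y) ≤ 0}.Nonempty := ⟨0, fun i => by simpa using h0 i⟩
  refine (le_infDist hne).2 fun w hw => ?_
  refine (infDist_le_dist_of_mem (s := {y | ∀ i, f i y ≤ 0}) (y := x₀ + w) hw).trans_eq ?_
  rw [dist_eq_norm, dist_eq_norm, sub_sub]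

theorem MvPolynomial.isPolyOnLines_eval {n d : ℕ} {p : MvPolynomial (Fin n) ℝ}
    (hp : p.totalDegree ≤ d) :
    IsPolyOnLines d (fun x : EuclideanSpace ℝ (Fin n) => MvPolynomial.eval (fun t => x t) p) := by
  intro x v
  refine ⟨MvPolynomial.aeval (fun i => Polynomial.C (x i) + Polynomial.C (v i) * Polynomial.X) p,
    ?_, fun t => ?_⟩
  · have := MvPolynomial.aeval_natDegree_le p hp
      (fun i => Polynomial.C (x i) + Polynomial.C (v i) * Polynomial.X) (n := 1)
      (fun i => by compute_degree)
    simpa using this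
  · have := MvPolynomial.comp_aeval_apply
      (fun i => Polynomial.C (x i) + Polynomial.C (v i) * Polynomial.X) (Polynomial.aeval t) p
    rw [Polynomial.coe_aeval_eq_eval] at this
    rw [this]
    change MvPolynomial.eval _ p = _
    rw [← MvPolynomial.aeval_eq_eval]
    congr 2
    funext i
    simp only [PiLp.add_apply, PiLp.smul_apply, smul_eq_mul, Polynomial.eval_add, Polynomial.eval_C,
      Polynomial.eval_mul, Polynomial.eval_X]
    ring

/-- Distances with the sufficient decrease property of exponent `q + 1` decay like
`k ^ (-1 / (2 * q))`. -/
theorem exists_rpow_decay {D : ℕ → ℝ} (hD : ∀ k, 0 ≤ D k) {C : ℝ} (hC : 0 < C) {q : ℕ}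
    (hq : 0 < q) (h : ∀ k, 1 ≤ k → D (k + 1) ^ 2 ≤ D k ^ 2 - (D k ^ (q + 1) / C) ^ 2) :
    ∃ M : ℝ, 0 < M ∧ ∀ k : ℕ, 1 ≤ k → D k ≤ M * (k : ℝ) ^ (-(1 / (2 * (q : ℝ)))) := by
  set w : ℕ → ℝ := fun k => D k ^ (2 * q) / C ^ 2 with hw
  have hw0 : ∀ k, 0 ≤ w k := fun k => by have := hD k; positivity
  have hrec : ∀ k, 1 ≤ k → w (k + 1) ≤ w k * (1 - w k) := by
    intro k hk
    have h1 : D (k + 1) ^ 2 ≤ D k ^ 2 * (1 - w k) := by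
      refine (h k hk).trans_eq ?_
      simp only [hw]
      field_simp
      ring
    rcases (hD k).eq_or_lt with h0 | hpos
    · have hz : D (k + 1) = 0 := by
        rw [← h0] at h1
        have := sq_nonneg (D (k + 1))
        exact pow_eq_zero_iff (two_ne_zero) |>.1 (by linarith)
      have h2q : 2 * q ≠ 0 := by omega
      simp [hw, hz, ← h0, h2q]
    · have hs : 0 ≤ 1 - w k := by
        have : 0 ≤ D k ^ 2 * (1 - w k) := (sq_nonneg _).trans h1
        exact nonneg_of_mul_nonneg_right this (by positivity)
      have h2 : D (k + 1) ^ (2 * q) ≤ D k ^ (2 * q) * (1 - w k) :=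
        calc D (k + 1) ^ (2 * q) = (D (k + 1) ^ 2) ^ q := pow_mul _ _ _
          _ ≤ (D k ^ 2 * (1 - w k)) ^ q := by gcongr
          _ = D k ^ (2 * q) * (1 - w k) ^ q := by rw [mul_pow, pow_mul]
          _ ≤ _ := by
            have := hD k
            gcongr
            exact pow_le_of_le_one hs (by linarith [hw0 k]) hq.ne'
      calc w (k + 1) = D (k + 1) ^ (2 * q) / C ^ 2 := rfl
        _ ≤ D k ^ (2 * q) * (1 - w k) / C ^ 2 := by gcongr
        _ = _ := by simp only [hw]; ring
  have hwk : ∀ k : ℕ, 1 ≤ k → w k ≤ 1 / k := by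
    intro k hk
    induction k, hk using Nat.le_induction with
    | base =>
      have h1 := hrec 1 le_rfl
      have h2 := hw0 2
      have h3 := hw0 1
      rw [Nat.cast_one, div_one]
      by_contra! hlt
      nlinarith
    | succ k hk ih =>
      have hk0 : (0 : ℝ) < k := by exact_mod_cast hk
      have h1 := hrec k hk
      rw [le_div_iff₀ hk0] at ih
      have h0 := hw0 k
      rw [Nat.cast_succ, le_div_iff₀ (by positivity)]
      have h2 : w k * (1 - w k) * (k + 1) ≤ 1 := by
        have hk1 : (1 : ℝ) ≤ k := by exact_mod_cast hk
        have hle : w k ≤ 1 := by nlinarith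
        nlinarith [mul_le_mul_of_nonneg_right ih (sub_nonneg.2 hle)]
      nlinarith
  refine ⟨(C ^ 2) ^ (1 / (2 * (q : ℝ))), by positivity, fun k hk => ?_⟩
  have hk0 : (0 : ℝ) < k := by exact_mod_cast hk
  have hq0 : (q : ℝ) ≠ 0 := by exact_mod_cast hq.ne'
  have h1 : D k ^ (2 * q) ≤ C ^ 2 * (k : ℝ)⁻¹ := by
    have := hwk k hk
    simp only [hw] at this
    rw [div_le_iff₀ (by positivity)] at this
    calc _ ≤ _ := this
      _ = _ := by ring
  have h2 : D k = (D k ^ (2 * q)) ^ (1 / (2 * (q : ℝ))) := by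
    rw [← Real.rpow_natCast, ← Real.rpow_mul (hD k)]
    push_cast
    rw [mul_one_div_cancel (by positivity), Real.rpow_one]
  rw [h2, Real.rpow_neg hk0.le, ← Real.inv_rpow hk0.le,
    ← Real.mul_rpow (by positivity) (by positivity)]
  exact Real.rpow_le_rpow (by have := hD k; positivity) h1 (by positivity)

/-- Distances with a linear sufficient decrease property decay geometrically. -/
theorem exists_geometric_decay {D : ℕ → ℝ} (hD : ∀ k, 0 ≤ D k) {C : ℝ} (hC : 0 < C)
    (h : ∀ k, 1 ≤ k → D (k + 1) ^ 2 ≤ D k ^ 2 - (D k / C) ^ 2) :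
    ∃ M : ℝ, 0 < M ∧ ∃ r ∈ Set.Ioo (0 : ℝ) 1, ∀ k : ℕ, 1 ≤ k → D k ≤ M * r ^ k := by
  set s : ℝ := C ^ 2 / (C ^ 2 + 1) with hs
  have hs0 : 0 < s := by positivity
  have hs1 : s < 1 := (div_lt_one (by positivity)).2 (by linarith)
  set r := Real.sqrt s with hr
  have hr0 : 0 < r := Real.sqrt_pos.2 hs0
  have hr1 : r < 1 := by rw [hr, Real.sqrt_lt' one_pos]; simpa using hs1
  have hstep : ∀ k, 1 ≤ k → D (k + 1) ≤ r * D k := by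
    intro k hk
    refine le_of_sq_le_sq ?_ (mul_nonneg hr0.le (hD k))
    rw [mul_pow, hr, Real.sq_sqrt hs0.le]
    refine (h k hk).trans ?_
    have : 1 - 1 / C ^ 2 ≤ s := by
      rw [hs, sub_le_iff_le_add, ← sub_le_iff_le_add', sub_le_iff_le_add]
      rw [div_add_div _ _ (by positivity) (by positivity), le_div_iff₀ (by positivity)]
      nlinarith [sq_nonneg (C ^ 2)]
    calc D k ^ 2 - (D k / C) ^ 2 = (1 - 1 / C ^ 2) * D k ^ 2 := by rw [div_pow]; ring
      _ ≤ _ := by gcongr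
  refine ⟨D 1 / r + 1, by have := hD 1; positivity, r, ⟨hr0, hr1⟩, fun k hk => ?_⟩
  induction k, hk using Nat.le_induction with
  | base =>
    rw [pow_one, add_mul, div_mul_cancel₀ _ hr0.ne']
    linarith
  | succ k hk ih =>
    calc D (k + 1) ≤ r * D k := hstep k hk
      _ ≤ r * ((D 1 / r + 1) * r ^ k) := by gcongr
      _ = _ := by ring

theorem norm_sq_add_norm_sq_le_of_nearest {V : Type*} [NormedAddCommGroup V]
    [InnerProductSpace ℝ V] {K : Set V} (hK : Convex ℝ K) {u v : V} (hv : v ∈ K)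
    (hmin : ∀ y ∈ K, dist u v ≤ dist u y) {p : V} (hp : p ∈ K) :
    ‖v - p‖ ^ 2 + ‖u - v‖ ^ 2 ≤ ‖u - p‖ ^ 2 := by
  have : Nonempty K := ⟨⟨v, hv⟩⟩
  have hinf : ‖u - v‖ = ⨅ w : K, ‖u - w‖ := by
    refine le_antisymm (le_ciInf fun w => ?_) (ciInf_le ⟨0, ?_⟩ (⟨v, hv⟩ : K))
    · simpa [dist_eq_norm] using hmin w w.2
    · rintro _ ⟨w, rfl⟩
      exact norm_nonneg _
  have hin := (norm_eq_iInf_iff_real_inner_le_zero hK hv).1 hinf p hp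
  have h := norm_sub_sq_real (u - v) (p - v)
  rw [sub_sub_sub_cancel_right] at h
  rw [norm_sub_rev v p]
  linarith

/-- A sequence in a complete space which is Fejér monotone with respect to a closed set and whose
distance to that set tends to zero converges to a point of the set, at the same rate. -/
theorem exists_tendsto_of_fejer {V : Type*} [NormedAddCommGroup V] [ProperSpace V]
    {S : Set V} (hS : IsClosed S) (hne : S.Nonempty) {a : ℕ → V}
    (hfejer : ∀ k, 1 ≤ k → ∀ p ∈ S, ‖a (k + 1) - p‖ ≤ ‖a k - p‖)
    (hdist : Tendsto (fun k => infDist (a k) S) atTop (nhds 0)) :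
    ∃ c ∈ S, Tendsto a atTop (nhds c) ∧ ∀ k, 1 ≤ k → ‖a k - c‖ ≤ 2 * infDist (a k) S := by
  have hmono : ∀ k, 1 ≤ k → ∀ j, k ≤ j → ∀ p ∈ S, ‖a j - p‖ ≤ ‖a k - p‖ := by
    intro k hk j hj p hp
    induction j, hj using Nat.le_induction with
    | base => exact le_rfl
    | succ j hj ih => exact (hfejer j (hk.trans hj) p hp).trans ih
  have hclose : ∀ k, 1 ≤ k → ∀ j, k ≤ j → dist (a k) (a j) ≤ 2 * infDist (a k) S := by
    intro k hk j hj
    obtain ⟨p, hp, hpd⟩ := hS.exists_infDist_eq_dist hne (a k)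
    have h1 := hmono k hk j hj p hp
    rw [← dist_eq_norm, ← dist_eq_norm] at h1
    have h2 := dist_triangle_right (a k) (a j) p
    linarith
  have hlim : Tendsto (fun k => 2 * infDist (a k) S) atTop (nhds 0) := by
    simpa using hdist.const_mul 2
  have hcauchy : CauchySeq a := by
    rw [Metric.cauchySeq_iff']
    intro ε hε
    obtain ⟨k, hk1, hk⟩ := ((eventually_ge_atTop 1).and (hlim.eventually_lt_const hε)).exists
    refine ⟨k, fun j hj => ?_⟩
    rw [dist_comm]
    exact (hclose k hk1 j hj).trans_lt hk
  obtain ⟨c, hc⟩ := cauchySeq_tendsto_of_complete hcauchy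
  refine ⟨c, ?_, hc, fun k hk => ?_⟩
  · rw [hS.mem_iff_infDist_zero hne]
    exact tendsto_nhds_unique (((continuous_infDist_pt S).tendsto c).comp hc) hdist
  · rw [← dist_eq_norm]
    exact le_of_tendsto (tendsto_const_nhds.dist hc)
      ((eventually_ge_atTop k).mono fun j hj => hclose k hk j hj)

theorem two_mul_pow_le_two_mul_sub_one_pow_add_one (d n : ℕ) (hd : 1 ≤ d) :
    2 * (d : ℝ) ^ n ≤ (2 * (d : ℝ) - 1) ^ n + 1 := by
  have hd1 : (1 : ℝ) ≤ d := by exact_mod_cast hd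
  induction n with
  | zero => norm_num
  | succ n ih =>
    have h1 : (1 : ℝ) ≤ (d : ℝ) ^ n := one_le_pow₀ hd1
    rw [pow_succ, pow_succ]
    have h2 := mul_le_mul_of_nonneg_right ih (by linarith : (0 : ℝ) ≤ 2 * d - 1)
    nlinarith [mul_nonneg (sub_nonneg.2 h1) (sub_nonneg.2 hd1)]

/-- Convergence rate of the alternating projection algorithm for two basic
semi-algebraic convex sets with nonempty intersection (Corollary 4.6). -/
theorem alternating_projection_rate_feasible
    (n m l d : ℕ) (hn : 0 < n) (hm : 0 < m) (hl : 0 < l) (hd : 0 < d)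
    (g : Fin m → EuclideanSpace ℝ (Fin n) → ℝ)
    (h : Fin l → EuclideanSpace ℝ (Fin n) → ℝ)
    (hgpoly : ∀ i, ∃ p : MvPolynomial (Fin n) ℝ, p.totalDegree ≤ d ∧
      ∀ x : EuclideanSpace ℝ (Fin n), g i x = MvPolynomial.eval (fun t => x t) p)
    (hhpoly : ∀ j, ∃ p : MvPolynomial (Fin n) ℝ, p.totalDegree ≤ d ∧
      ∀ x : EuclideanSpace ℝ (Fin n), h j x = MvPolynomial.eval (fun t => x t) p)
    (hgconv : ∀ i, ConvexOn ℝ Set.univ (g i))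
    (hhconv : ∀ j, ConvexOn ℝ Set.univ (h j))
    (A B : Set (EuclideanSpace ℝ (Fin n)))
    (hA : A = {x | ∀ i, g i x ≤ 0}) (hB : B = {x | ∀ j, h j x ≤ 0})
    (hAB : (A ∩ B).Nonempty)
    -- the alternating projection sequences: `a (k+1)` is the nearest point of `A`
    -- to `b k`, and `b (k+1)` is the nearest point of `B` to `a (k+1)`
    (a b : ℕ → EuclideanSpace ℝ (Fin n))
    (ha : ∀ k : ℕ, a (k + 1) ∈ A ∧ ∀ y ∈ A, dist (b k) (a (k + 1)) ≤ dist (b k) y)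
    (hb : ∀ k : ℕ, b (k + 1) ∈ B ∧
      ∀ y ∈ B, dist (a (k + 1)) (b (k + 1)) ≤ dist (a (k + 1)) y)
    (ρ : ℝ)
    (hρ : ρ = 1 / min ((2 * (d : ℝ) - 1) ^ n - 1)
                      (2 * (Nat.choose (n - 1) ((n - 1) / 2) : ℝ) * (d : ℝ) ^ n - 2)) :
    ∃ c ∈ A ∩ B, Tendsto a atTop (nhds c) ∧ Tendsto b atTop (nhds c) ∧
      ∃ M > (0 : ℝ), ∃ r₀ ∈ Set.Ioo (0 : ℝ) 1, ∀ k : ℕ, 1 ≤ k →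
        (1 < d → ‖a k - c‖ ≤ M * (k : ℝ) ^ (-ρ) ∧ ‖b k - c‖ ≤ M * (k : ℝ) ^ (-ρ)) ∧
        (d = 1 → ‖a k - c‖ ≤ M * r₀ ^ k ∧ ‖b k - c‖ ≤ M * r₀ ^ k) := by
  classical
  obtain ⟨x₀, hx₀A, hx₀B⟩ := hAB
  set f : Fin m ⊕ Fin l → EuclideanSpace ℝ (Fin n) → ℝ := Sum.elim g h with hf
  have hfconv : ∀ i, ConvexOn ℝ Set.univ (f i) := by
    rintro (i | j)
    exacts [hgconv i, hhconv j]
  have hfpoly : ∀ i, IsPolyOnLines d (f i) := by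
    rintro (i | j)
    · obtain ⟨p, hp, hgp⟩ := hgpoly i
      have : f (Sum.inl i) = _ := funext hgp
      exact this ▸ MvPolynomial.isPolyOnLines_eval hp
    · obtain ⟨p, hp, hhp⟩ := hhpoly j
      have : f (Sum.inr j) = _ := funext hhp
      exact this ▸ MvPolynomial.isPolyOnLines_eval hp
  have hAeq : A = ⋂ i, {x | g i x ≤ 0} := by rw [hA]; ext; simp
  have hBeq : B = ⋂ j, {x | h j x ≤ 0} := by rw [hB]; ext; simp
  have hS : A ∩ B = {y | ∀ i, f i y ≤ 0} := by
    ext y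
    simp [hA, hB, hf]
  have hAconv : Convex ℝ A := by
    rw [hAeq]
    exact convex_iInter fun i => by simpa using (hgconv i).convex_le 0
  have hBconv : Convex ℝ B := by
    rw [hBeq]
    exact convex_iInter fun j => by simpa using (hhconv j).convex_le 0
  have hSclosed : IsClosed (A ∩ B) := by
    rw [hAeq, hBeq]
    exact (isClosed_iInter fun i => isClosed_le (hgconv i).locallyLipschitz.continuous
      continuous_const).inter (isClosed_iInter fun j =>
        isClosed_le (hhconv j).locallyLipschitz.continuous continuous_const)
  have hSne : (A ∩ B).Nonempty := ⟨x₀, hx₀A, hx₀B⟩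
  have hstepA : ∀ k, ∀ p ∈ A ∩ B, ‖a (k + 1) - p‖ ≤ ‖b k - p‖ := fun k p hp => by
    have := norm_sq_add_norm_sq_le_of_nearest hAconv (ha k).1 (ha k).2 hp.1
    exact le_of_sq_le_sq (by nlinarith [sq_nonneg ‖b k - a (k + 1)‖]) (norm_nonneg _)
  have hstepB : ∀ k, 1 ≤ k → ∀ p ∈ A ∩ B,
      ‖b k - p‖ ^ 2 + ‖a k - b k‖ ^ 2 ≤ ‖a k - p‖ ^ 2 := fun k hk p hp => by
    obtain ⟨k, rfl⟩ := Nat.exists_eq_add_of_le' hk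
    exact norm_sq_add_norm_sq_le_of_nearest hBconv (hb k).1 (hb k).2 hp.2
  have hstepB' : ∀ k, 1 ≤ k → ∀ p ∈ A ∩ B, ‖b k - p‖ ≤ ‖a k - p‖ := fun k hk p hp => by
    have := hstepB k hk p hp
    exact le_of_sq_le_sq (by nlinarith [sq_nonneg ‖a k - b k‖]) (norm_nonneg _)
  have hfejer : ∀ k, 1 ≤ k → ∀ p ∈ A ∩ B, ‖a (k + 1) - p‖ ≤ ‖a k - p‖ := fun k hk p hp =>
    (hstepA k p hp).trans (hstepB' k hk p hp)
  set R := ‖b 0 - x₀‖ with hRdef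
  have hRa : ∀ k, 1 ≤ k → ‖a k - x₀‖ ≤ R := fun k hk => by
    induction k, hk using Nat.le_induction with
    | base => exact hstepA 0 x₀ ⟨hx₀A, hx₀B⟩
    | succ k hk ih => exact (hfejer k hk x₀ ⟨hx₀A, hx₀B⟩).trans ih
  set D : ℕ → ℝ := fun k => infDist (a k) (A ∩ B) with hDdef
  have hD0 : ∀ k, 0 ≤ D k := fun k => infDist_nonneg
  obtain ⟨C₁, hC₁, herr⟩ := exists_infDist_pow_le_residual_of_feasible hd hfconv hfpoly
    (x₀ := x₀) (by rintro (i | j); exacts [(hA ▸ hx₀A : _) i, (hB ▸ hx₀B : _) j])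
    (R := R) (norm_nonneg _)
  rw [← hS, finrank_euclideanSpace_fin] at herr
  obtain ⟨K, hK, hlip⟩ := ConvexOn.exists_lipschitz_closedBall hfconv (R + ‖x₀‖)
  have hball : ∀ x : EuclideanSpace ℝ (Fin n), ‖x - x₀‖ ≤ R → ‖x‖ ≤ R + ‖x₀‖ := fun x hx => by
    have := norm_add_le (x - x₀) x₀
    rw [sub_add_cancel] at this
    linarith
  have hbound : ∀ k, 1 ≤ k → D k ^ d ^ n ≤ (C₁ * K) * ‖a k - b k‖ := fun k hk => by
    have hak := hRa k hk
    have hbk := (hstepB' k hk x₀ ⟨hx₀A, hx₀B⟩).trans hak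
    rw [mul_assoc]
    refine herr (a k) hak _ (by positivity) ?_
    obtain ⟨k, rfl⟩ := Nat.exists_eq_add_of_le' hk
    rintro (i | j)
    · have hi : g i (a (k + 1)) ≤ 0 := (hA ▸ (ha k).1 : _) i
      exact hi.trans (by positivity)
    · have hj : h j (b (k + 1)) ≤ 0 := (hB ▸ (hb k).1 : _) j
      have hlj : h j (a (k + 1)) ≤ _ :=
        hlip (Sum.inr j) (a (k + 1)) (b (k + 1)) (hball _ hak) (hball _ hbk)
      change h j (a (k + 1)) ≤ _
      refine hlj.trans ?_
      change h j (b (k + 1)) + _ ≤ _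
      linarith
  have hC : 0 < C₁ * K := by positivity
  have hdecr : ∀ k, 1 ≤ k → D (k + 1) ^ 2 ≤ D k ^ 2 - (D k ^ d ^ n / (C₁ * K)) ^ 2 := by
    intro k hk
    obtain ⟨p, hp, hpd⟩ := hSclosed.exists_infDist_eq_dist hSne (a k)
    rw [dist_eq_norm] at hpd
    have h1 : D (k + 1) ≤ ‖b k - p‖ := by
      refine (infDist_le_dist_of_mem hp).trans ?_
      rw [dist_eq_norm]
      exact hstepA k p hp
    have h2 := hstepB k hk p hp
    have h3 : D k ^ d ^ n / (C₁ * K) ≤ ‖a k - b k‖ := by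
      rw [div_le_iff₀ hC, mul_comm]
      exact hbound k hk
    have h4 := pow_le_pow_left₀ (hD0 (k + 1)) h1 2
    have h5 := pow_le_pow_left₀ (by have := hD0 k; positivity) h3 2
    have h6 : D k ^ 2 = ‖a k - p‖ ^ 2 := by rw [hDdef]; simp only; rw [hpd]
    linarith
  have hconverge : Tendsto D atTop (nhds 0) → ∃ c ∈ A ∩ B, Tendsto a atTop (nhds c) ∧
      Tendsto b atTop (nhds c) ∧ ∀ k, 1 ≤ k → ‖a k - c‖ ≤ 2 * D k ∧ ‖b k - c‖ ≤ 2 * D k := by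
    intro hlim
    obtain ⟨c, hcS, hac, hrate⟩ := exists_tendsto_of_fejer hSclosed hSne hfejer hlim
    have hb' : ∀ k, 1 ≤ k → ‖b k - c‖ ≤ 2 * D k := fun k hk =>
      (hstepB' k hk c hcS).trans (hrate k hk)
    refine ⟨c, hcS, hac, ?_, fun k hk => ⟨hrate k hk, hb' k hk⟩⟩
    rw [tendsto_iff_norm_sub_tendsto_zero]
    refine squeeze_zero' (Eventually.of_forall fun k => norm_nonneg _)
      ((eventually_ge_atTop 1).mono hb') ?_
    simpa using hlim.const_mul 2
  rcases (Nat.one_le_iff_ne_zero.2 hd.ne').eq_or_lt with hd1 | hd1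
  · subst hd1
    simp only [one_pow, pow_one] at hdecr
    obtain ⟨M, hM, r, hr, hrate⟩ := exists_geometric_decay hD0 hC hdecr
    obtain ⟨c, hcS, hac, hbc, hc⟩ := hconverge (by
      refine squeeze_zero' (Eventually.of_forall hD0) ((eventually_ge_atTop 1).mono hrate) ?_
      simpa using (tendsto_pow_atTop_nhds_zero_of_lt_one hr.1.le hr.2).const_mul M)
    refine ⟨c, hcS, hac, hbc, 2 * M, by positivity, r, hr, fun k hk =>
      ⟨fun hlt => absurd hlt (lt_irrefl _), fun _ => ?_⟩⟩
    have h1 := hrate k hk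
    have h2 := hc k hk
    constructor <;> linarith [h2.1, h2.2]
  · obtain ⟨q, hq⟩ : ∃ q, d ^ n = q + 1 := Nat.exists_eq_add_of_le' (Nat.one_le_pow _ _ hd)
    have hq0 : 0 < q := by
      have := Nat.one_lt_pow hn.ne' hd1
      omega
    rw [hq] at hdecr
    obtain ⟨M, hM, hrate⟩ := exists_rpow_decay hD0 hC hq0 hdecr
    have hqR : (0 : ℝ) < q := by exact_mod_cast hq0
    obtain ⟨c, hcS, hac, hbc, hc⟩ := hconverge (by
      refine squeeze_zero' (Eventually.of_forall hD0) ((eventually_ge_atTop 1).mono hrate) ?_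
      simpa using ((tendsto_rpow_neg_atTop
        (by positivity : (0 : ℝ) < 1 / (2 * (q : ℝ)))).comp
          tendsto_natCast_atTop_atTop).const_mul M)
    refine ⟨c, hcS, hac, hbc, 2 * M, by positivity, 1 / 2, by norm_num, fun k hk =>
      ⟨fun _ => ?_, fun h1 => absurd h1 hd1.ne'⟩⟩
    have hqd : (d : ℝ) ^ n = q + 1 := by exact_mod_cast hq
    have hρq : ρ ≤ 1 / (2 * (q : ℝ)) := by
      rw [hρ]
      refine one_div_le_one_div_of_le (by positivity) (le_min ?_ ?_)
      · have := two_mul_pow_le_two_mul_sub_one_pow_add_one d n hd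
        linarith
      · have hch : (1 : ℝ) ≤ Nat.choose (n - 1) ((n - 1) / 2) := by
          exact_mod_cast Nat.choose_pos (Nat.div_le_self _ _)
        rw [hqd]
        nlinarith
    have hpow : (k : ℝ) ^ (-(1 / (2 * (q : ℝ)))) ≤ (k : ℝ) ^ (-ρ) :=
      Real.rpow_le_rpow_of_exponent_le (by exact_mod_cast hk) (neg_le_neg hρq)
    have h1 := (hrate k hk).trans (mul_le_mul_of_nonneg_left hpow hM.le)
    have h2 := hc k hk
    constructor <;> linarith [h2.1, h2.2]
end
end

section
/- Let g_1, …, g_m and h_1, …, h_l be convex polynomials on ℝ^n, and set A := {x ∈ ℝ^n : g_i(x) ≤ 0, i = 1, …, m} and B := {x ∈ ℝ^n : h_j(x) ≤ 0, j = 1, …, l}; assume A and B are nonempty. Then the set B − A := {b − a : b ∈ B, a ∈ A} is closed in ℝ^n. -/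
open Metric Set Filter
open scoped BigOperators Pointwise

noncomputable section

open scoped Topology Polynomial

section LinewisePolynomial

variable {E F : Type*} [NormedAddCommGroup E] [NormedSpace ℝ E]
  [NormedAddCommGroup F] [NormedSpace ℝ F]

/-- A convex function whose restriction to every line is a polynomial in the line parameter. -/
structure IsConvexLinewisePolynomial (f : E → ℝ) : Prop where
  convexOn : ConvexOn ℝ univ f
  exists_polynomial : ∀ x v : E, ∃ p : ℝ[X], ∀ t : ℝ, f (x + t • v) = p.eval t

theorem IsConvexLinewisePolynomial.comp_linearMap {f : F → ℝ}
    (hf : IsConvexLinewisePolynomial f) (L : E →ₗ[ℝ] F) :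
    IsConvexLinewisePolynomial (fun z => f (L z)) where
  convexOn := hf.convexOn.comp_linearMap L
  exists_polynomial x v := by
    obtain ⟨p, hp⟩ := hf.exists_polynomial (L x) (L v)
    exact ⟨p, fun t => by simpa using hp t⟩

theorem isConvexLinewisePolynomial_norm_sub_sq {H : Type*} [NormedAddCommGroup H]
    [InnerProductSpace ℝ H] (y : H) :
    IsConvexLinewisePolynomial (fun z : H => ‖z - y‖ ^ 2) where
  convexOn := by
    have hdist := (convexOn_univ_dist y).pow (fun _ _ => dist_nonneg) 2
    exact hdist.congr fun z _ => by simp [dist_eq_norm]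
  exists_polynomial x v := by
    refine ⟨.C (‖x - y‖ ^ 2) + .C (2 * inner ℝ (x - y) v) * .X + .C (‖v‖ ^ 2) * .X ^ 2,
      fun t => ?_⟩
    rw [add_sub_right_comm, norm_add_sq_real, inner_smul_right, norm_smul, mul_pow,
      Real.norm_eq_abs, sq_abs]
    simp
    ring

theorem isConvexLinewisePolynomial_of_mvPolynomial {n : ℕ} {f : EuclideanSpace ℝ (Fin n) → ℝ}
    (hf : ConvexOn ℝ univ f)
    (hp : ∃ p : MvPolynomial (Fin n) ℝ,
      ∀ x : EuclideanSpace ℝ (Fin n), f x = MvPolynomial.eval (fun i => x i) p) :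
    IsConvexLinewisePolynomial f where
  convexOn := hf
  exists_polynomial x v := by
    obtain ⟨p, hp⟩ := hp
    refine ⟨MvPolynomial.aeval (fun i => .C (x i) + .X * .C (v i)) p, fun t => ?_⟩
    rw [hp, ← Polynomial.coe_evalRingHom, MvPolynomial.map_aeval]
    simp only [MvPolynomial.eval, MvPolynomial.coe_eval₂Hom]
    congr 1
    · ext r
      simp
    · ext i
      simpa using mul_comm _ _

/-- A convex polynomial bounded above on the half-line `[0, ∞)` has degree at most one. -/
theorem Polynomial.degree_le_one_of_convexOn_of_le {p : ℝ[X]} {M : ℝ}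
    (hp : ConvexOn ℝ univ fun t => p.eval t) (hM : ∀ t, 0 ≤ t → p.eval t ≤ M) :
    p.degree ≤ 1 := by
  by_contra! hdeg
  have hlim := p.abs_div_tendsto_atTop_atTop_of_degree_gt .X (by simpa using hdeg)
    Polynomial.X_ne_zero
  obtain ⟨t, ht, ht1⟩ := ((hlim.eventually_gt_atTop
    (|M| + 2 * |p.eval 0| + |p.eval (-1)|)).and (eventually_ge_atTop 1)).exists
  have ht0 : 0 < t := by linarith
  have h1 := hM t ht0.le
  have hconv := hp.2 (mem_univ t) (mem_univ (-1)) (show 0 ≤ 1 / (1 + t) by positivity)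
    (show 0 ≤ t / (1 + t) by positivity) (by field_simp)
  have hzero : (1 / (1 + t)) • t + (t / (1 + t)) • (-1 : ℝ) = 0 := by
    simp only [smul_eq_mul]
    field_simp
    ring
  rw [hzero] at hconv
  have h2 : (1 + t) * p.eval 0 ≤ p.eval t + t * p.eval (-1) := by
    simp only [smul_eq_mul] at hconv
    have hmul := mul_le_mul_of_nonneg_left hconv (show 0 ≤ 1 + t by linarith)
    refine hmul.trans_eq ?_
    field_simp
  rw [Polynomial.eval_X, abs_div, abs_of_pos ht0, lt_div_iff₀ ht0] at ht
  have hM' : |M| ≤ t * |M| := le_mul_of_one_le_left (abs_nonneg _) ht1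
  have h0' : |p.eval 0| ≤ t * |p.eval 0| := le_mul_of_one_le_left (abs_nonneg _) ht1
  have hlow : -(t * |p.eval (-1)|) ≤ -(t * p.eval (-1)) :=
    neg_le_neg (mul_le_mul_of_nonneg_left (le_abs_self _) ht0.le)
  have h0 : -((1 + t) * |p.eval 0|) ≤ (1 + t) * p.eval 0 := by
    rw [← mul_neg]
    exact mul_le_mul_of_nonneg_left (neg_abs_le _) (by linarith)
  have habs : |p.eval t| ≤ (|M| + 2 * |p.eval 0| + |p.eval (-1)|) * t := by
    have hn1 : 0 ≤ t * |p.eval (-1)| := by positivity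
    have hn0 : 0 ≤ t * |p.eval 0| := by positivity
    have hnM : 0 ≤ t * |M| := by positivity
    rw [abs_le]
    constructor
    · nlinarith
    · nlinarith [le_abs_self M]
  linarith

/-- Linear upper bounds for a convex function along a sequence going to infinity in the
direction `v` are inherited by all rays in the direction `v`. -/
theorem ConvexOn.add_smul_le_of_tendsto {f : E → ℝ} (hf : ConvexOn ℝ univ f)
    (hcont : Continuous f) {z : ℕ → E} {r : ℕ → ℝ} {v : E} {a c : ℝ}
    (hr : Tendsto r atTop atTop) (hz : Tendsto (fun k => (r k)⁻¹ • z k) atTop (𝓝 v))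
    (hfz : ∀ k, f (z k) ≤ a + r k * c) (x : E) {t : ℝ} (ht : 0 ≤ t) :
    f (x + t • v) ≤ f x + t * c := by
  have hinv : Tendsto (fun k => (r k)⁻¹) atTop (𝓝 0) := tendsto_inv_atTop_zero.comp hr
  have hw : Tendsto (fun k => t * (r k)⁻¹) atTop (𝓝 0) := by simpa using hinv.const_mul t
  have hpt : Tendsto (fun k => (1 - t * (r k)⁻¹) • x + t • ((r k)⁻¹ • z k)) atTop
      (𝓝 (x + t • v)) := by
    simpa using ((hw.const_sub 1).smul_const x).add (hz.const_smul t)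
  have hbound : Tendsto (fun k => (1 - t * (r k)⁻¹) * f x + (t * (r k)⁻¹ * a + t * c)) atTop
      (𝓝 (f x + t * c)) := by
    simpa using ((hw.const_sub 1).mul_const (f x)).add ((hw.mul_const a).add_const (t * c))
  refine le_of_tendsto_of_tendsto ((hcont.tendsto _).comp hpt) hbound ?_
  filter_upwards [hr.eventually_gt_atTop 0, hr.eventually_ge_atTop t] with k hk0 hkt
  have hw0 : 0 ≤ t * (r k)⁻¹ := by positivity
  have hw1 : t * (r k)⁻¹ ≤ 1 := by
    rw [← div_eq_mul_inv]
    exact div_le_one_of_le₀ hkt hk0.le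
  have hconv := hf.2 (mem_univ x) (mem_univ (z k)) (sub_nonneg.2 hw1) hw0 (by ring)
  simp only [smul_eq_mul] at hconv
  rw [Function.comp_apply, smul_smul]
  refine hconv.trans ?_
  have hmul := mul_le_mul_of_nonneg_left (hfz k) hw0
  have hcancel : t * (r k)⁻¹ * (a + r k * c) = t * (r k)⁻¹ * a + t * c := by
    field_simp
  linarith

/-- A convex linewise polynomial function which is nonincreasing in the direction `v` is affine
in that direction, with the same slope on all parallel lines. -/
theorem IsConvexLinewisePolynomial.exists_slope {f : E → ℝ} (hf : IsConvexLinewisePolynomial f)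
    (hcont : Continuous f) {v : E} (hv : ∀ x, ∀ t : ℝ, 0 ≤ t → f (x + t • v) ≤ f x) :
    ∃ c ≤ 0, ∀ x, ∀ t : ℝ, f (x + t • v) = f x + t * c := by
  have hline : ∀ x, ∃ c, ∀ t : ℝ, f (x + t • v) = f x + t * c := fun x => by
    obtain ⟨p, hp⟩ := hf.exists_polynomial x v
    have hpconv : ConvexOn ℝ univ fun t => p.eval t := by
      have hcomp := hf.convexOn.comp_affineMap (AffineMap.lineMap x (x + v) : ℝ →ᵃ[ℝ] E)
      refine hcomp.congr fun t _ => ?_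
      simp [← hp, AffineMap.lineMap_apply, add_comm]
    have hdeg := Polynomial.degree_le_one_of_convexOn_of_le hpconv
      (M := f x) fun t ht => hp t ▸ hv x t ht
    rw [Polynomial.eq_X_add_C_of_degree_le_one hdeg] at hp
    have h0 := hp 0
    refine ⟨p.coeff 1, fun t => ?_⟩
    simp only [zero_smul, add_zero, Polynomial.eval_add, Polynomial.eval_mul, Polynomial.eval_C,
      Polynomial.eval_X, mul_zero, zero_add] at h0 hp
    rw [hp, h0]
    ring
  choose c hc using hline
  have hle : ∀ x y, c x ≤ c y := fun x y => by
    have hlim : Tendsto (fun k : ℕ => ((k : ℝ))⁻¹ • (y + (k : ℝ) • v)) atTop (𝓝 v) := by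
      have hsum : Tendsto (fun k : ℕ => ((k : ℝ))⁻¹ • y + v) atTop (𝓝 v) := by
        simpa using ((tendsto_inv_atTop_nhds_zero_nat (𝕜 := ℝ)).smul_const y).add_const v
      refine hsum.congr' ?_
      filter_upwards [eventually_gt_atTop 0] with k hk
      have hk' : (k : ℝ) ≠ 0 := by positivity
      rw [smul_add, inv_smul_smul₀ hk']
    have hslope := hf.convexOn.add_smul_le_of_tendsto hcont tendsto_natCast_atTop_atTop hlim
      (fun k => (hc y k).le) x zero_le_one
    rw [hc] at hslope
    linarith
  refine ⟨c 0, ?_, fun x t => by rw [hc, (hle x 0).antisymm (hle 0 x)]⟩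
  have h1 := hv 0 1 zero_le_one
  rw [hc] at h1
  linarith

/-- A sequence in a finite-dimensional space has a convergent subsequence, or a subsequence
going to infinity in a limiting direction. -/
theorem exists_subseq_tendsto_or_direction [FiniteDimensional ℝ E] (z : ℕ → E) :
    (∃ a, ∃ φ : ℕ → ℕ, StrictMono φ ∧ Tendsto (z ∘ φ) atTop (𝓝 a)) ∨
    ∃ v ≠ 0, ∃ φ : ℕ → ℕ, StrictMono φ ∧ Tendsto (fun k => ‖z (φ k)‖) atTop atTop ∧
      Tendsto (fun k => ‖z (φ k)‖⁻¹ • z (φ k)) atTop (𝓝 v) := by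
  have : ProperSpace E := FiniteDimensional.proper ℝ E
  by_cases hfreq : ∃ R, ∃ᶠ k in atTop, z k ∈ closedBall 0 R
  · obtain ⟨R, hR⟩ := hfreq
    obtain ⟨a, -, φ, hφ, ha⟩ := tendsto_subseq_of_frequently_bounded isBounded_closedBall hR
    exact .inl ⟨a, φ, hφ, ha⟩
  · push Not at hfreq
    have hinf : Tendsto (fun k => ‖z k‖) atTop atTop := tendsto_atTop.2 fun R => by
      filter_upwards [hfreq R] with k hk
      simpa using (not_le.1 (mt mem_closedBall_zero_iff.2 hk)).le
    have hsphere : ∃ᶠ k in atTop, ‖z k‖⁻¹ • z k ∈ sphere (0 : E) 1 := by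
      refine Eventually.frequently ?_
      filter_upwards [hinf.eventually_gt_atTop 0] with k hk
      simp [norm_smul, hk.ne']
    obtain ⟨v, hv, φ, hφ, hlim⟩ := tendsto_subseq_of_frequently_bounded isBounded_sphere hsphere
    rw [isClosed_sphere.closure_eq] at hv
    exact .inr ⟨v, ne_of_mem_sphere hv one_ne_zero, φ, hφ, hinf.comp hφ.tendsto_atTop, hlim⟩

/-- A finite system of convex linewise polynomial inequalities which is solvable up to every
positive error is solvable. -/
theorem exists_forall_le_zero_of_forall_pos [FiniteDimensional ℝ E] {ι : Type*}
    {f : ι → E → ℝ} (hf : ∀ i, IsConvexLinewisePolynomial (f i)) (s : Finset ι)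
    (W : Submodule ℝ E) (h : ∀ ε > 0, ∃ z ∈ W, ∀ i ∈ s, f i z ≤ ε) :
    ∃ z ∈ W, ∀ i ∈ s, f i z ≤ 0 := by
  have hcont : ∀ i, Continuous (f i) := fun i =>
    continuousOn_univ.1 ((hf i).convexOn.continuousOn isOpen_univ)
  induction hN : Module.finrank ℝ W + s.card using Nat.strong_induction_on generalizing s W with
  | _ N ih =>
  choose z hzW hz using fun k : ℕ => h (1 / (k + 1)) Nat.one_div_pos_of_nat
  obtain ⟨a, φ, hφ, ha⟩ | ⟨v, hv0, φ, hφ, hnorm, hv⟩ := exists_subseq_tendsto_or_direction z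
  · refine ⟨a, W.closed_of_finiteDimensional.mem_of_tendsto ha
      (.of_forall fun k => hzW (φ k)), fun i hi => ?_⟩
    exact le_of_tendsto_of_tendsto (((hcont i).tendsto a).comp ha)
      (tendsto_one_div_add_atTop_nhds_zero_nat.comp hφ.tendsto_atTop)
      (.of_forall fun k => hz (φ k) i hi)
  have hvW : v ∈ W := W.closed_of_finiteDimensional.mem_of_tendsto hv
    (.of_forall fun k => W.smul_mem _ (hzW (φ k)))
  have hslope : ∀ i ∈ s, ∃ c ≤ 0, ∀ x, ∀ t : ℝ, f i (x + t • v) = f i x + t * c := by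
    refine fun i hi => (hf i).exists_slope (hcont i) fun x t ht => ?_
    have hrec := (hf i).convexOn.add_smul_le_of_tendsto (hcont i) (a := 1) (c := 0) hnorm hv
      (fun k => ?_) x ht
    · simpa using hrec
    · simpa using (hz (φ k) i hi).trans (div_le_one_of_le₀ (by simp) (by positivity))
  choose! c hc0 hc using hslope
  by_cases hall : ∀ i ∈ s, c i = 0
  · obtain ⟨ℓ, hℓ⟩ := SeparatingDual.exists_eq_one (R := ℝ) hv0
    have hlt : W ⊓ ℓ.ker < W := by
      refine inf_le_left.lt_of_ne fun heq => ?_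
      have hmem : v ∈ W ⊓ ℓ.ker := heq.symm.le hvW
      simp [hℓ] at hmem
    have hrank := Submodule.finrank_lt_finrank_of_lt hlt
    have hker : ∀ ε > 0, ∃ x ∈ W ⊓ ℓ.ker, ∀ i ∈ s, f i x ≤ ε := fun ε hε => by
      obtain ⟨x, hxW, hx⟩ := h ε hε
      refine ⟨x + (-ℓ x) • v, ⟨W.add_mem hxW (W.smul_mem _ hvW), by simp [hℓ]⟩, fun i hi => ?_⟩
      rw [hc i hi, hall i hi, mul_zero, add_zero]
      exact hx i hi
    obtain ⟨x, hx, hxs⟩ := ih _ (by omega) s (W ⊓ ℓ.ker) hker rfl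
    exact ⟨x, hx.1, hxs⟩
  · push Not at hall
    obtain ⟨j, hjs, hj⟩ := hall
    have hcard : (s.filter fun i => c i = 0).card < s.card :=
      Finset.card_lt_card (Finset.filter_ssubset.2 ⟨j, hjs, hj⟩)
    obtain ⟨x, hxW, hx⟩ := ih _ (by omega) (s.filter fun i => c i = 0) W (fun ε hε =>
      (h ε hε).imp fun y hy => ⟨hy.1, fun i hi => hy.2 i (Finset.filter_subset _ _ hi)⟩) rfl
    have hlarge : ∀ᶠ t : ℝ in atTop, ∀ i ∈ s, f i (x + t • v) ≤ 0 := by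
      refine (Finset.eventually_all s).2 fun i hi => ?_
      by_cases hci : c i = 0
      · refine .of_forall fun t => ?_
        rw [hc i hi, hci, mul_zero, add_zero]
        exact hx i (Finset.mem_filter.2 ⟨hi, hci⟩)
      · have hneg : Tendsto (fun t : ℝ => f i x + t * c i) atTop atBot :=
          tendsto_atBot_add_const_left _ _
            (tendsto_id.atTop_mul_const_of_neg ((hc0 i hi).lt_of_ne hci))
        filter_upwards [hneg.eventually_le_atBot 0] with t ht
        rwa [hc i hi]
    obtain ⟨t, ht⟩ := hlarge.exists
    exact ⟨x + t • v, W.add_mem hxW (W.smul_mem _ hvW), ht⟩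

end LinewisePolynomial

/-- The difference of two basic semi-algebraic convex sets is closed (Lemma 4.7). -/
theorem difference_of_basic_semialgebraic_convex_sets_isClosed
    (n m l : ℕ) (hm : 0 < m) (hl : 0 < l)
    (g : Fin m → EuclideanSpace ℝ (Fin n) → ℝ)
    (h : Fin l → EuclideanSpace ℝ (Fin n) → ℝ)
    (hgpoly : ∀ i, ∃ p : MvPolynomial (Fin n) ℝ,
      ∀ x : EuclideanSpace ℝ (Fin n), g i x = MvPolynomial.eval (fun t => x t) p)
    (hhpoly : ∀ j, ∃ p : MvPolynomial (Fin n) ℝ,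
      ∀ x : EuclideanSpace ℝ (Fin n), h j x = MvPolynomial.eval (fun t => x t) p)
    (hgconv : ∀ i, ConvexOn ℝ Set.univ (g i))
    (hhconv : ∀ j, ConvexOn ℝ Set.univ (h j))
    (A B : Set (EuclideanSpace ℝ (Fin n)))
    (hA : A = {x | ∀ i, g i x ≤ 0}) (hB : B = {x | ∀ j, h j x ≤ 0})
    (hAne : A.Nonempty) (hBne : B.Nonempty) :
    IsClosed (B - A) := by
  refine isClosed_of_closure_subset fun y hy => ?_
  let f : Option (Fin m ⊕ Fin l) →
      EuclideanSpace ℝ (Fin n) × EuclideanSpace ℝ (Fin n) → ℝ := fun k =>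
    match k with
    | none => fun z => ‖(z.1 - z.2) - y‖ ^ 2
    | some (.inl i) => fun z => g i z.2
    | some (.inr j) => fun z => h j z.1
  have hf : ∀ k, IsConvexLinewisePolynomial (f k) := by
    let L₁ := LinearMap.fst ℝ (EuclideanSpace ℝ (Fin n)) (EuclideanSpace ℝ (Fin n))
    let L₂ := LinearMap.snd ℝ (EuclideanSpace ℝ (Fin n)) (EuclideanSpace ℝ (Fin n))
    rintro (_ | i | j)
    · exact (isConvexLinewisePolynomial_norm_sub_sq y).comp_linearMap (L₁ - L₂)
    · exact (isConvexLinewisePolynomial_of_mvPolynomial (hgconv i) (hgpoly i)).comp_linearMap L₂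
    · exact (isConvexLinewisePolynomial_of_mvPolynomial (hhconv j) (hhpoly j)).comp_linearMap L₁
  obtain ⟨⟨b, a⟩, -, hab⟩ := exists_forall_le_zero_of_forall_pos hf Finset.univ ⊤ fun ε hε => by
    obtain ⟨_, ⟨b, hb, a, ha, rfl⟩, hdist⟩ := Metric.mem_closure_iff.1 hy _ (Real.sqrt_pos.2 hε)
    rw [hA] at ha
    rw [hB] at hb
    refine ⟨(b, a), trivial, ?_⟩
    rintro (_ | i | j) -
    · rw [dist_comm, dist_eq_norm] at hdist
      exact (Real.le_sqrt (norm_nonneg _) hε.le).1 hdist.le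
    · exact (ha i).trans hε.le
    · exact (hb j).trans hε.le
  rw [hA, hB]
  refine ⟨b, fun j => hab (some (.inr j)) (Finset.mem_univ _), a,
    fun i => hab (some (.inl i)) (Finset.mem_univ _), ?_⟩
  have hnorm : ‖(b - a) - y‖ ^ 2 ≤ 0 := hab none (Finset.mem_univ _)
  exact sub_eq_zero.1 (norm_eq_zero.1 (pow_eq_zero_iff two_ne_zero |>.1
    (hnorm.antisymm (sq_nonneg _))))
end
end

section
/- Let g_1, …, g_m and h_1, …, h_l be convex polynomials on ℝ^n, and set A := {x ∈ ℝ^n : g_i(x) ≤ 0, i = 1, …, m} and B := {x ∈ ℝ^n : h_j(x) ≤ 0, j = 1, …, l}; assume A and B are nonempty. Then the distance between A and B is attained: there exist a ∈ A and b ∈ B such that ‖b − a‖ = inf{‖b' − a'‖ : a' ∈ A, b' ∈ B}. -/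
open Metric Set Filter
open scoped BigOperators

noncomputable section

/-- A real polynomial which is convex and bounded above on `[0, ∞)` is affine and nonincreasing. -/
theorem Polynomial.exists_eval_eq_sub_mul_of_convexOn {p : Polynomial ℝ} {M : ℝ}
    (hp : ConvexOn ℝ univ fun t => p.eval t) (hM : ∀ t, 0 ≤ t → p.eval t ≤ M) :
    ∃ c, 0 ≤ c ∧ ∀ t, p.eval t = p.eval 0 - t * c := by
  have hdiv : ∀ t, p.eval t = t * p.divX.eval t + p.eval 0 := fun t => by
    conv_lhs => rw [← p.divX_mul_X_add]
    simp [Polynomial.coeff_zero_eq_eval_zero, mul_comm]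
  have hlow : ∀ t : ℝ, 1 ≤ t → p.eval 1 - p.eval 0 ≤ p.divX.eval t := fun t ht => by
    have ht0 : 0 < t := by linarith
    have h1 := hp.2 (mem_univ 0) (mem_univ t) (show 0 ≤ 1 - t⁻¹
      by have := inv_le_one_of_one_le₀ ht; linarith) (show 0 ≤ t⁻¹ by positivity) (by ring)
    simp only [smul_eq_mul, mul_zero, zero_add, inv_mul_cancel₀ ht0.ne'] at h1
    have h2 : t⁻¹ * p.eval t = p.divX.eval t + t⁻¹ * p.eval 0 := by
      rw [hdiv t]; field_simp
    linarith
  have hup : ∀ t : ℝ, 1 ≤ t → p.divX.eval t ≤ M - p.eval 0 := fun t ht => by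
    have h1 := hM t (by linarith)
    have h2 := hM 0 le_rfl
    rw [hdiv t] at h1
    by_contra! hlt
    nlinarith
  have hdeg : p.divX.degree ≤ 0 := by
    rw [← Polynomial.isBoundedUnder_abs_atTop_iff]
    refine ⟨max |p.eval 1 - p.eval 0| |M - p.eval 0|, ?_⟩
    rw [eventually_map]
    filter_upwards [eventually_ge_atTop 1] with t ht
    exact abs_le_max_abs_abs (hlow t ht) (hup t ht)
  obtain ⟨c, hc⟩ : ∃ c, ∀ t, p.eval t = p.eval 0 + t * c := by
    refine ⟨p.divX.coeff 0, fun t => ?_⟩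
    rw [hdiv t, Polynomial.eq_C_of_degree_le_zero hdeg]
    simp [add_comm]
  refine ⟨-c, ?_, fun t => by rw [hc t]; ring⟩
  by_contra! hneg
  have hcpos : 0 < c := by linarith
  have h0 : 0 ≤ M - p.eval 0 := by linarith [hM 0 le_rfl]
  have h1 := hM ((M - p.eval 0 + 1) / c) (by positivity)
  rw [hc, div_mul_cancel₀ _ hcpos.ne'] at h1
  linarith

section ConvexPolynomialSystems

variable {E : Type*} [NormedAddCommGroup E] [NormedSpace ℝ E]

/-- If a convex function restricts to a polynomial on every line and is bounded above on every
half-line of direction `v`, then it decreases at a constant rate along `v`. -/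
theorem ConvexOn.exists_add_smul_eq_sub_mul {f : E → ℝ} (hf : ConvexOn ℝ univ f) {v : E}
    (hpoly : ∀ x, ∃ p : Polynomial ℝ, ∀ t : ℝ, f (x + t • v) = p.eval t)
    (hbdd : ∀ x, ∃ M, ∀ t : ℝ, 0 ≤ t → f (x + t • v) ≤ M) :
    ∃ c, 0 ≤ c ∧ ∀ x (t : ℝ), f (x + t • v) = f x - t * c := by
  have hline : ∀ x, ∃ c, 0 ≤ c ∧ ∀ t : ℝ, f (x + t • v) = f x - t * c := by
    intro x
    obtain ⟨p, hp⟩ := hpoly x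
    obtain ⟨M, hM⟩ := hbdd x
    have hconv : ConvexOn ℝ univ fun t => p.eval t := by
      have := hf.comp_affineMap (AffineMap.lineMap x (x + v))
      rw [preimage_univ] at this
      refine this.congr fun t _ => ?_
      rw [← hp t, Function.comp_apply, AffineMap.lineMap_apply]
      simp [add_comm]
    obtain ⟨c, hc, hpc⟩ := Polynomial.exists_eval_eq_sub_mul_of_convexOn hconv
      fun t ht => hp t ▸ hM t ht
    have h0 : f x = p.eval 0 := by simpa using hp 0
    exact ⟨c, hc, fun t => by rw [hp, hpc, h0]⟩
  choose c hc hfc using hline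
  have hmid : ∀ x y, c ((1 / 2 : ℝ) • x + (1 / 2 : ℝ) • y) = c x := by
    intro x y
    set z := (1 / 2 : ℝ) • x + (1 / 2 : ℝ) • y with hz
    have key : ∀ t : ℝ, f z - t * c z ≤ (f x + f y) / 2 - t * c x := by
      intro t
      have h1 := hf.2 (mem_univ (x + (2 * t) • v)) (mem_univ y)
        (show (0 : ℝ) ≤ 1 / 2 by norm_num) (show (0 : ℝ) ≤ 1 / 2 by norm_num) (by norm_num)
      have h2 : (1 / 2 : ℝ) • (x + (2 * t) • v) + (1 / 2 : ℝ) • y = z + t • v := by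
        rw [hz]; module
      rw [h2, hfc, hfc] at h1
      simp only [smul_eq_mul] at h1
      linarith
    by_contra hne
    have hd : c x - c z ≠ 0 := fun h => hne (by linarith)
    have h1 := key (((f x + f y) / 2 - f z + 1) / (c x - c z))
    have h2 : ((f x + f y) / 2 - f z + 1) / (c x - c z) * (c x - c z)
        = (f x + f y) / 2 - f z + 1 := div_mul_cancel₀ _ hd
    linarith
  refine ⟨c 0, hc 0, fun x t => ?_⟩
  rw [hfc x t, ← hmid x 0, ← hmid 0 x, add_comm]

/-- The limit of the normalizations of an unbounded sequence in a sublevel set of a continuous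
convex function is a direction of recession. -/
theorem ConvexOn.add_smul_le_max_of_tendsto {f : E → ℝ} (hf : ConvexOn ℝ univ f)
    (hcont : Continuous f) {u : ℕ → E} {v : E} {M : ℝ} (hu : ∀ k, f (u k) ≤ M)
    (hnorm : Tendsto (fun k => ‖u k‖) atTop atTop)
    (hv : Tendsto (fun k => ‖u k‖⁻¹ • u k) atTop (nhds v)) (x : E) {t : ℝ} (ht : 0 ≤ t) :
    f (x + t • v) ≤ max (f x) M := by
  have hinv : Tendsto (fun k => t * ‖u k‖⁻¹) atTop (nhds 0) := by
    simpa using (tendsto_inv_atTop_zero.comp hnorm).const_mul t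
  have hlim : Tendsto (fun k => (1 - t * ‖u k‖⁻¹) • x + (t * ‖u k‖⁻¹) • u k) atTop
      (nhds (x + t • v)) := by
    have h1 := ((hinv.const_sub 1).smul_const x).add (hv.const_smul t)
    simpa [smul_smul] using h1
  refine le_of_tendsto ((hcont.tendsto _).comp hlim) ?_
  filter_upwards [hinv.eventually_le_const one_pos] with k hk
  refine (hf.le_max_of_mem_segment (mem_univ x) (mem_univ (u k)) ?_).trans
    (max_le_max le_rfl (hu k))
  exact ⟨_, _, sub_nonneg.2 hk, by positivity, by ring, rfl⟩

/-- A finite system of inequalities `f i ≤ 0`, where the `f i` are convex and polynomial on lines,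
is solvable as soon as it is approximately solvable. -/
theorem exists_forall_le_zero_of_forall_pos_exists_le [FiniteDimensional ℝ E] {ι : Type*}
    (f : ι → E → ℝ) (hconv : ∀ i, ConvexOn ℝ univ (f i))
    (hpoly : ∀ i x v, ∃ p : Polynomial ℝ, ∀ t : ℝ, f i (x + t • v) = p.eval t)
    (s : Finset ι) (happrox : ∀ ε : ℝ, 0 < ε → ∃ x, ∀ i ∈ s, f i x ≤ ε) :
    ∃ x, ∀ i ∈ s, f i x ≤ 0 := by
  classical
  have : ProperSpace E := FiniteDimensional.proper ℝ E
  have hcont : ∀ i, Continuous (f i) := fun i => by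
    simpa [continuousOn_univ] using (hconv i).continuousOn isOpen_univ
  induction s using Finset.strongInduction with
  | H s ih =>
  have hmin : ∀ k : ℕ, ∃ x, (∀ i ∈ s, f i x ≤ 1 / ((k : ℝ) + 1)) ∧
      ∀ y, (∀ i ∈ s, f i y ≤ 1 / ((k : ℝ) + 1)) → ‖x‖ ≤ ‖y‖ := by
    intro k
    have hclosed : IsClosed {x | ∀ i ∈ s, f i x ≤ 1 / ((k : ℝ) + 1)} := by
      simp only [ofPred_forall]
      exact isClosed_biInter fun i _ => isClosed_le (hcont i) continuous_const
    obtain ⟨x, hx, hxd⟩ := hclosed.exists_infDist_eq_dist (happrox _ (by positivity)) 0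
    refine ⟨x, hx, fun y hy => ?_⟩
    rw [← dist_zero_left, ← dist_zero_left, ← hxd]
    exact infDist_le_dist_of_mem hy
  choose x hx hxmin using hmin
  by_cases hbdd : Tendsto (fun k => ‖x k‖) atTop atTop
  · have hball : ∀ k, ‖x k‖⁻¹ • x k ∈ closedBall (0 : E) 1 := fun k => by
      rw [mem_closedBall_zero_iff, norm_smul, norm_inv, norm_norm]
      exact inv_mul_le_one
    obtain ⟨v, -, φ, hφ, hv⟩ := (isCompact_closedBall (0 : E) 1).tendsto_subseq hball
    have hnorm : Tendsto (fun k => ‖x (φ k)‖) atTop atTop := hbdd.comp hφ.tendsto_atTop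
    have hrec : ∀ i ∈ s, ∃ c, 0 ≤ c ∧ ∀ y (t : ℝ), f i (y + t • v) = f i y - t * c := by
      intro i hi
      refine (hconv i).exists_add_smul_eq_sub_mul (fun y => hpoly i y v) fun y =>
        ⟨max (f i y) 1, fun t ht => ?_⟩
      refine (hconv i).add_smul_le_max_of_tendsto (hcont i) (fun k => ?_) hnorm hv y ht
      refine (hx (φ k) i hi).trans ?_
      rw [div_le_one (by positivity)]
      linarith [(φ k).cast_nonneg (α := ℝ)]
    by_cases hall : ∀ i ∈ s, ∀ y (t : ℝ), f i (y + t • v) = f i y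
    · exfalso
      have hclose : ∀ᶠ k in atTop, ‖‖x (φ k)‖⁻¹ • x (φ k) - v‖ < 1 := by
        have := (tendsto_iff_norm_sub_tendsto_zero.1 hv).eventually_lt_const one_pos
        exact this
      obtain ⟨k, hk, hpos⟩ := (hclose.and (hnorm.eventually_gt_atTop 0)).exists
      have hle := hxmin (φ k) (x (φ k) + (-‖x (φ k)‖) • v) fun i hi => by
        rw [hall i hi]; exact hx (φ k) i hi
      have heq : x (φ k) + (-‖x (φ k)‖) • v
          = ‖x (φ k)‖ • (‖x (φ k)‖⁻¹ • x (φ k) - v) := by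
        rw [smul_sub, smul_inv_smul₀ hpos.ne', neg_smul, sub_eq_add_neg]
      rw [heq, norm_smul, norm_norm] at hle
      nlinarith
    · push Not at hall
      obtain ⟨j, hj, y₀, t₀, hne⟩ := hall
      obtain ⟨y, hy⟩ := ih (s.erase j) (Finset.erase_ssubset hj) fun ε hε =>
        (happrox ε hε).imp fun x hx i hi => hx i (Finset.mem_of_mem_erase hi)
      obtain ⟨c, hc, hfc⟩ := hrec j hj
      have hcpos : 0 < c := hc.lt_of_ne fun h => hne (by rw [hfc, ← h]; ring)
      refine ⟨y + (|f j y| / c) • v, fun i hi => ?_⟩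
      by_cases hij : i = j
      · rw [hij, hfc, div_mul_cancel₀ _ hcpos.ne']
        linarith [le_abs_self (f j y)]
      · obtain ⟨d, hd, hfd⟩ := hrec i hi
        rw [hfd]
        have h1 := hy i (Finset.mem_erase.2 ⟨hij, hi⟩)
        have h2 : 0 ≤ |f j y| / c * d := by positivity
        linarith
  · obtain ⟨R, hR⟩ : ∃ R, ∃ᶠ k in atTop, ‖x k‖ < R := by
      rw [Filter.tendsto_atTop] at hbdd
      push Not at hbdd
      exact hbdd
    obtain ⟨y, -, φ, hφ, hy⟩ := (isCompact_closedBall (0 : E) R).tendsto_subseq'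
      (hR.mono fun k hk => mem_closedBall_zero_iff.2 hk.le)
    refine ⟨y, fun i hi => ?_⟩
    exact le_of_tendsto_of_tendsto' (((hcont i).tendsto y).comp hy)
      (tendsto_one_div_add_atTop_nhds_zero_nat.comp hφ.tendsto_atTop) fun k => hx (φ k) i hi

end ConvexPolynomialSystems

/-- The restriction of a multivariate polynomial to a line is a univariate polynomial. -/
theorem MvPolynomial.exists_eval_add_mul_eq {σ R : Type*} [CommSemiring R] (p : MvPolynomial σ R)
    (x v : σ → R) :
    ∃ q : Polynomial R, ∀ t, MvPolynomial.eval (fun i => x i + t * v i) p = q.eval t := by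
  refine ⟨MvPolynomial.aeval
    (fun i => Polynomial.C (x i) + Polynomial.X * Polynomial.C (v i)) p, fun t => ?_⟩
  induction p using MvPolynomial.induction_on with
  | C a => simp
  | add p q hp hq => simp [hp, hq]
  | mul_X p i hp => simp only [map_mul, MvPolynomial.eval_X, MvPolynomial.aeval_X, hp,
      Polynomial.eval_mul, Polynomial.eval_add, Polynomial.eval_C, Polynomial.eval_X]

/-- The squared norm restricted to a line is a polynomial. -/
theorem exists_norm_add_smul_sq_eq_eval {E : Type*} [NormedAddCommGroup E]
    [InnerProductSpace ℝ E] (x v : E) :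
    ∃ q : Polynomial ℝ, ∀ t : ℝ, ‖x + t • v‖ ^ 2 = q.eval t := by
  refine ⟨Polynomial.C (‖x‖ ^ 2) + Polynomial.X * Polynomial.C (2 * inner ℝ x v)
    + Polynomial.X ^ 2 * Polynomial.C (‖v‖ ^ 2), fun t => ?_⟩
  rw [norm_add_sq_real, inner_smul_right, norm_smul, mul_pow, Real.norm_eq_abs, sq_abs]
  simp
  ring

/-- The squared distance is jointly convex. -/
theorem convexOn_norm_snd_sub_fst_sq (E : Type*) [NormedAddCommGroup E] [NormedSpace ℝ E] :
    ConvexOn ℝ univ fun z : E × E => ‖z.2 - z.1‖ ^ 2 := by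
  have h := (convexOn_univ_norm (E := E)).comp_linearMap
    (LinearMap.snd ℝ E E - LinearMap.fst ℝ E E)
  rw [preimage_univ] at h
  exact h.pow (fun _ _ => norm_nonneg _) 2

/-- The distance between two basic semi-algebraic convex sets is attained
(Remark 4.8). -/
theorem distance_between_basic_semialgebraic_convex_sets_attained
    (n m l : ℕ) (hm : 0 < m) (hl : 0 < l)
    (g : Fin m → EuclideanSpace ℝ (Fin n) → ℝ)
    (h : Fin l → EuclideanSpace ℝ (Fin n) → ℝ)
    (hgpoly : ∀ i, ∃ p : MvPolynomial (Fin n) ℝ,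
      ∀ x : EuclideanSpace ℝ (Fin n), g i x = MvPolynomial.eval (fun t => x t) p)
    (hhpoly : ∀ j, ∃ p : MvPolynomial (Fin n) ℝ,
      ∀ x : EuclideanSpace ℝ (Fin n), h j x = MvPolynomial.eval (fun t => x t) p)
    (hgconv : ∀ i, ConvexOn ℝ Set.univ (g i))
    (hhconv : ∀ j, ConvexOn ℝ Set.univ (h j))
    (A B : Set (EuclideanSpace ℝ (Fin n)))
    (hA : A = {x | ∀ i, g i x ≤ 0}) (hB : B = {x | ∀ j, h j x ≤ 0})
    (hAne : A.Nonempty) (hBne : B.Nonempty) :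
    ∃ a ∈ A, ∃ b ∈ B,
      ‖b - a‖ = sInf {r : ℝ | ∃ a' ∈ A, ∃ b' ∈ B, r = ‖b' - a'‖} := by
  subst hA hB
  obtain ⟨a₀, ha₀⟩ := hAne
  obtain ⟨b₀, hb₀⟩ := hBne
  set T := {r : ℝ | ∃ a' ∈ {x | ∀ i, g i x ≤ 0}, ∃ b' ∈ {x | ∀ j, h j x ≤ 0}, r = ‖b' - a'‖}
  have hTne : T.Nonempty := ⟨_, a₀, ha₀, b₀, hb₀, rfl⟩
  have hTnonneg : ∀ r ∈ T, 0 ≤ r := by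
    rintro r ⟨a, -, b, -, rfl⟩
    exact norm_nonneg _
  have hd : 0 ≤ sInf T := Real.sInf_nonneg hTnonneg
  have hdle : ∀ r ∈ T, sInf T ≤ r := fun r hr => csInf_le ⟨0, hTnonneg⟩ hr
  have hdlt : ∀ e, sInf T < e → ∃ r ∈ T, r < e := fun e he => exists_lt_of_csInf_lt hTne he
  generalize sInf T = d at *
  let F : Option (Fin m ⊕ Fin l) → EuclideanSpace ℝ (Fin n) × EuclideanSpace ℝ (Fin n) → ℝ
    | none => fun z => ‖z.2 - z.1‖ ^ 2 - d ^ 2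
    | some (.inl i) => fun z => g i z.1
    | some (.inr j) => fun z => h j z.2
  obtain ⟨⟨a, b⟩, hab⟩ := exists_forall_le_zero_of_forall_pos_exists_le F
    (by
      rintro (_ | i | j)
      · exact (convexOn_norm_snd_sub_fst_sq _).sub (concaveOn_const (d ^ 2) convex_univ)
      · exact (hgconv i).comp_linearMap (LinearMap.fst ℝ _ _)
      · exact (hhconv j).comp_linearMap (LinearMap.snd ℝ _ _))
    (by
      rintro (_ | i | j) x v
      · obtain ⟨q, hq⟩ := exists_norm_add_smul_sq_eq_eval (x.2 - x.1) (v.2 - v.1)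
        refine ⟨q - Polynomial.C (d ^ 2), fun t => ?_⟩
        rw [Polynomial.eval_sub, Polynomial.eval_C, ← hq, smul_sub, sub_add_sub_comm]
        rfl
      · obtain ⟨p, hp⟩ := hgpoly i
        obtain ⟨q, hq⟩ := p.exists_eval_add_mul_eq x.1 v.1
        exact ⟨q, fun t => (hp _).trans (hq t)⟩
      · obtain ⟨p, hp⟩ := hhpoly j
        obtain ⟨q, hq⟩ := p.exists_eval_add_mul_eq x.2 v.2
        exact ⟨q, fun t => (hp _).trans (hq t)⟩)
    Finset.univ
    (by
      intro ε hε
      have hlt : d < √(d ^ 2 + ε) := Real.lt_sqrt_of_sq_lt (by linarith)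
      obtain ⟨_, ⟨a, ha, b, hb, rfl⟩, hr⟩ := hdlt _ hlt
      refine ⟨(a, b), ?_⟩
      rintro (_ | i | j) -
      · have := (Real.lt_sqrt (norm_nonneg _)).1 hr
        change ‖b - a‖ ^ 2 - d ^ 2 ≤ ε
        linarith
      · exact (ha i).trans hε.le
      · exact (hb j).trans hε.le)
  have ha : a ∈ {x | ∀ i, g i x ≤ 0} := fun i => hab (some (.inl i)) (Finset.mem_univ _)
  have hb : b ∈ {x | ∀ j, h j x ≤ 0} := fun j => hab (some (.inr j)) (Finset.mem_univ _)
  refine ⟨a, ha, b, hb, le_antisymm ?_ (hdle _ ⟨a, ha, b, hb, rfl⟩)⟩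
  have h1 : ‖b - a‖ ^ 2 - d ^ 2 ≤ 0 := hab none (Finset.mem_univ _)
  exact le_of_sq_le_sq (by linarith) hd
end
end

section
/- Let p > 0 and let (β_k)_{k≥0} and (δ_k)_{k≥0} be sequences of nonnegative real numbers satisfying β_{k+1} ≤ β_k·(1 − δ_k·β_k^p) for all k ≥ 0. Then for every k ≥ 1, β_k ≤ ( β_0^{−p} + p·Σ_{i=0}^{k−1} δ_i )^{−1/p}, with the convention that 1/0 = +∞ (so the inequality is automatic if β_0 = 0). In particular, β_k → 0 whenever Σ_{k=0}^∞ δ_k = ∞. -/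
open Filter
open scoped BigOperators

noncomputable section

/-- One step of the recurrence increases `b ^ (-p)` by at least `p * d`. -/
theorem rpow_neg_add_le_of_le_mul {p b b' d : ℝ} (hp : 0 < p) (hb : 0 ≤ b) (hb' : 0 < b')
    (h : b' ≤ b * (1 - d * b ^ p)) : 0 < b ∧ b ^ (-p) + p * d ≤ b' ^ (-p) := by
  have hb₀ : 0 < b := hb.lt_of_ne' (by rintro rfl; linarith [zero_mul (1 - d * (0 : ℝ) ^ p)])
  refine ⟨hb₀, ?_⟩
  have hle : b' ≤ b * Real.exp (-(d * b ^ p)) :=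
    h.trans (mul_le_mul_of_nonneg_left (Real.one_sub_le_exp_neg _) hb)
  have hcancel : b ^ (-p) * b ^ p = 1 := by
    rw [← Real.rpow_add hb₀, neg_add_cancel, Real.rpow_zero]
  calc b ^ (-p) + p * d = b ^ (-p) * (p * (d * b ^ p) + 1) := by
        linear_combination -(p * d) * hcancel
    _ ≤ b ^ (-p) * Real.exp (p * (d * b ^ p)) := by
        gcongr
        exact Real.add_one_le_exp _
    _ = (b * Real.exp (-(d * b ^ p))) ^ (-p) := by
        rw [Real.mul_rpow hb (Real.exp_pos _).le, ← Real.exp_mul]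
        ring_nf
    _ ≤ b' ^ (-p) := Real.rpow_le_rpow_of_nonpos hb' hle (neg_nonpos.mpr hp.le)

/-- As long as the sequence stays positive, `β k ^ (-p)` dominates the accumulated increments. -/
theorem rpow_neg_add_sum_le {p : ℝ} (hp : 0 < p) {β δ : ℕ → ℝ} (hβ : ∀ k, 0 ≤ β k)
    (hrec : ∀ k, β (k + 1) ≤ β k * (1 - δ k * β k ^ p)) (k : ℕ) (hk : 0 < β k) :
    β 0 ^ (-p) + p * ∑ i ∈ Finset.range k, δ i ≤ β k ^ (-p) := by
  induction k with
  | zero => simp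
  | succ k ih =>
    obtain ⟨hpos, hstep⟩ := rpow_neg_add_le_of_le_mul hp (hβ k) hk (hrec k)
    rw [Finset.sum_range_succ]
    linarith [ih hpos]

/-- The recurrence preserves vanishing. -/
theorem eq_zero_of_recurrence {p : ℝ} {β δ : ℕ → ℝ} (hβ : ∀ k, 0 ≤ β k)
    (hrec : ∀ k, β (k + 1) ≤ β k * (1 - δ k * β k ^ p)) (h₀ : β 0 = 0) (k : ℕ) : β k = 0 := by
  induction k with
  | zero => exact h₀
  | succ k ih => exact le_antisymm (by simpa [ih] using hrec k) (hβ _)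

/-- Recurrence relationships (Lemma 4.1). -/
theorem recurrence_relation_rate
    (p : ℝ) (hp : 0 < p) (β δ : ℕ → ℝ)
    (hβ : ∀ k, 0 ≤ β k) (hδ : ∀ k, 0 ≤ δ k)
    (hrec : ∀ k : ℕ, β (k + 1) ≤ β k * (1 - δ k * β k ^ p)) :
    (∀ k : ℕ, 1 ≤ k → β 0 ≠ 0 →
      β k ≤ (β 0 ^ (-p) + p * ∑ i ∈ Finset.range k, δ i) ^ (-(1 / p))) ∧
    (∀ k : ℕ, 1 ≤ k → β 0 = 0 → β k ≤ 0) ∧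
    (Tendsto (fun k => ∑ i ∈ Finset.range k, δ i) atTop atTop →
      Tendsto β atTop (nhds 0)) := by
  have hrate (k : ℕ) (h₀ : β 0 ≠ 0) :
      β k ≤ (β 0 ^ (-p) + p * ∑ i ∈ Finset.range k, δ i) ^ (-(1 / p)) := by
    have hsum : 0 ≤ ∑ i ∈ Finset.range k, δ i := Finset.sum_nonneg fun i _ => hδ i
    have hpos : 0 < β 0 ^ (-p) + p * ∑ i ∈ Finset.range k, δ i :=
      add_pos_of_pos_of_nonneg (Real.rpow_pos_of_pos ((hβ 0).lt_of_ne' h₀) _)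
        (mul_nonneg hp.le hsum)
    rcases (hβ k).eq_or_lt with hk | hk
    · rw [← hk]
      positivity
    · calc β k = (β k ^ (-p)) ^ (-(1 / p)) := by
            rw [← Real.rpow_mul hk.le, neg_mul_neg, mul_one_div_cancel hp.ne', Real.rpow_one]
        _ ≤ _ := Real.rpow_le_rpow_of_nonpos hpos (rpow_neg_add_sum_le hp hβ hrec k hk)
            (neg_nonpos.mpr (one_div_pos.mpr hp).le)
  refine ⟨fun k _ => hrate k, fun k _ h₀ => (eq_zero_of_recurrence hβ hrec h₀ k).le, fun hδ' => ?_⟩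
  by_cases h₀ : β 0 = 0
  · simp [funext (eq_zero_of_recurrence hβ hrec h₀)]
  · exact squeeze_zero hβ (fun k => hrate k h₀) <|
      (tendsto_rpow_neg_atTop (one_div_pos.mpr hp)).comp
        (tendsto_atTop_add_const_left _ _ (hδ'.const_mul_atTop hp))
end
end

section
/- Let D_1, …, D_m ⊆ ℝ^n be nonempty closed convex sets, let x_0 ∈ ℝ^n, and let (x_k) be the sequence of cyclic projections onto D_1, …, D_m starting at x_0, with α_k := (k mod m) + 1 the index used at step k. Then for every k ≥ 0 and every index l ∈ {1, …, m}: dist(x_k, D_l) ≤ dist(x_k, D_{α_k}) + dist(x_{k+1}, D_{α_{k+1}}) + ⋯ + dist(x_{k+m−1}, D_{α_{k+m−1}}). -/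
open Metric Set Filter
open scoped BigOperators

noncomputable section

/-- Distance comparison along one cycle of the cyclic projection algorithm
(inequality (4.3) in the proof of Proposition 4.2). -/
theorem cyclic_projection_distance_along_cycle
    (n m : ℕ) (hm : 0 < m)
    (D : Fin m → Set (EuclideanSpace ℝ (Fin n)))
    (hDne : ∀ i, (D i).Nonempty) (hDcl : ∀ i, IsClosed (D i))
    (hDcv : ∀ i, Convex ℝ (D i))
    -- the sequence of cyclic projections: `x (k+1)` is the nearest point of
    -- `D (k % m)` to `x k`
    (x : ℕ → EuclideanSpace ℝ (Fin n))
    (hx : ∀ k : ℕ, x (k + 1) ∈ D ⟨k % m, Nat.mod_lt k hm⟩ ∧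
      ∀ y ∈ D ⟨k % m, Nat.mod_lt k hm⟩, dist (x k) (x (k + 1)) ≤ dist (x k) y) :
    ∀ k : ℕ, ∀ l : Fin m,
      Metric.infDist (x k) (D l) ≤
        ∑ j ∈ Finset.range m,
          Metric.infDist (x (k + j)) (D ⟨(k + j) % m, Nat.mod_lt (k + j) hm⟩) := by
  have dist_le_infDist (i : ℕ) :
      dist (x i) (x (i + 1)) ≤ Metric.infDist (x i) (D ⟨i % m, Nat.mod_lt i hm⟩) :=
    (Metric.le_infDist (hDne _)).2 fun {y} hy => (hx i).2 y hy
  intro k l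
  obtain ⟨j, hj, hjl⟩ : ∃ j < m, (k + j) % m = l := by
    refine ⟨(l + (m - k % m)) % m, Nat.mod_lt _ hm, ?_⟩
    have hk := Nat.mod_lt k hm
    rw [Nat.add_mod_mod, ← Nat.mod_add_mod,
      show k % m + (l + (m - k % m)) = l + m by omega, Nat.add_mod_right,
      Nat.mod_eq_of_lt l.2]
  have hmem : x (k + (j + 1)) ∈ D l := by
    have hl : (⟨(k + j) % m, Nat.mod_lt (k + j) hm⟩ : Fin m) = l := Fin.ext hjl
    exact hl ▸ (hx (k + j)).1
  calc Metric.infDist (x k) (D l)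
      ≤ dist (x k) (x (k + (j + 1))) := Metric.infDist_le_dist_of_mem hmem
    _ ≤ ∑ i ∈ Finset.range (j + 1), dist (x (k + i)) (x (k + i + 1)) :=
        dist_le_range_sum_dist (fun i => x (k + i)) (j + 1)
    _ ≤ ∑ i ∈ Finset.range m, dist (x (k + i)) (x (k + i + 1)) :=
        Finset.sum_le_sum_of_subset_of_nonneg (Finset.range_mono hj)
          fun _ _ _ => dist_nonneg
    _ ≤ _ := Finset.sum_le_sum fun i _ => dist_le_infDist (k + i)
end
end

section
/- Let g_1, …, g_m be convex polynomials on ℝ^n, let S := {x ∈ ℝ^n : g_i(x) ≤ 0 for all i = 1, …, m}, and let x̄ ∈ S. Suppose the Slater condition holds: there exists x_0 ∈ ℝ^n with g_i(x_0) < 0 for all i = 1, …, m. Then there exist constants c > 0 and ε > 0 such that dist(x, S) ≤ c·max_{1 ≤ i ≤ m} [g_i(x)]_+ for all x ∈ ℝ^n with ‖x − x̄‖ ≤ ε. -/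
open Metric Set Filter
open scoped BigOperators

noncomputable section

/-- A finite system of convex inequalities with a Slater point `x₀` satisfies a global error bound
whose constant grows linearly in the distance to `x₀`. -/
theorem infDist_le_of_convexOn_of_slater {ι E : Type*} [Finite ι] [SeminormedAddCommGroup E]
    [NormedSpace ℝ E] {g : ι → E → ℝ} (hconv : ∀ i, ConvexOn ℝ Set.univ (g i))
    {x₀ : E} {δ : ℝ} (hδ : 0 < δ) (hx₀ : ∀ i, g i x₀ ≤ -δ) (x : E) :
    Metric.infDist x {y | ∀ i, g i y ≤ 0} ≤ ‖x₀ - x‖ / δ * ⨆ i, max (g i x) 0 := by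
  set F : ℝ := ⨆ i, max (g i x) 0 with hF
  have hF0 : 0 ≤ F := Real.iSup_nonneg fun i => le_max_right _ _
  have hgF : ∀ i, g i x ≤ F := fun i =>
    (le_max_left _ _).trans (le_ciSup (f := fun i => max (g i x) 0) (Set.finite_range _).bddAbove i)
  have hpos : 0 < F + δ := by positivity
  have hsum : δ / (F + δ) + F / (F + δ) = 1 := by field_simp; ring
  set y : E := (δ / (F + δ)) • x + (F / (F + δ)) • x₀ with hy
  have hyS : y ∈ {y | ∀ i, g i y ≤ 0} := fun i => by
    calc g i y ≤ δ / (F + δ) * g i x + F / (F + δ) * g i x₀ :=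
          (hconv i).2 (Set.mem_univ _) (Set.mem_univ _) (by positivity) (by positivity) hsum
      _ ≤ δ / (F + δ) * F + F / (F + δ) * -δ := by
          gcongr
          · exact hgF i
          · exact hx₀ i
      _ = 0 := by ring
  have hxy : y - x = (F / (F + δ)) • (x₀ - x) := by
    rw [hy, eq_sub_of_add_eq hsum]
    module
  calc Metric.infDist x {y | ∀ i, g i y ≤ 0} ≤ dist x y := Metric.infDist_le_dist_of_mem hyS
    _ = F / (F + δ) * ‖x₀ - x‖ := by
        rw [dist_comm, dist_eq_norm, hxy, norm_smul, Real.norm_of_nonneg (by positivity)]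
    _ ≤ F / δ * ‖x₀ - x‖ := by
        gcongr
        linarith
    _ = ‖x₀ - x‖ / δ * F := by ring

/-- Lipschitz-type local error bound under the Slater condition. -/
theorem local_lipschitz_error_bound_slater
    (n m : ℕ) (hn : 0 < n) (hm : 0 < m)
    (g : Fin m → EuclideanSpace ℝ (Fin n) → ℝ)
    (hpoly : ∀ i, ∃ p : MvPolynomial (Fin n) ℝ,
      ∀ x : EuclideanSpace ℝ (Fin n), g i x = MvPolynomial.eval (fun j => x j) p)
    (hconv : ∀ i, ConvexOn ℝ Set.univ (g i))
    (S : Set (EuclideanSpace ℝ (Fin n)))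
    (hS : S = {x | ∀ i, g i x ≤ 0})
    (xbar : EuclideanSpace ℝ (Fin n)) (hxbar : xbar ∈ S)
    (x₀ : EuclideanSpace ℝ (Fin n)) (hslater : ∀ i, g i x₀ < 0) :
    ∃ c > (0 : ℝ), ∃ ε > (0 : ℝ), ∀ x : EuclideanSpace ℝ (Fin n), ‖x - xbar‖ ≤ ε →
      Metric.infDist x S ≤ c * ⨆ i, max (g i x) 0 := by
  subst hS
  have : Nonempty (Fin m) := ⟨⟨0, hm⟩⟩
  obtain ⟨j, hj⟩ := Finite.exists_max fun i => g i x₀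
  have hδ : 0 < -g j x₀ := neg_pos.2 (hslater j)
  refine ⟨(‖x₀ - xbar‖ + 1) / -g j x₀, by positivity, 1, one_pos, fun x hx => ?_⟩
  refine (infDist_le_of_convexOn_of_slater hconv hδ (fun i => by simpa using hj i) x).trans ?_
  have hF0 : 0 ≤ ⨆ i, max (g i x) 0 := Real.iSup_nonneg fun i => le_max_right _ _
  have hdist : ‖x₀ - x‖ ≤ ‖x₀ - xbar‖ + 1 := by
    rw [norm_sub_rev] at hx
    linarith [norm_sub_le_norm_sub_add_norm_sub x₀ xbar x]
  gcongr
end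
end

section
/- Let d, m be positive integers and let g_1, …, g_m be convex polynomials on ℝ (one real variable), each of degree at most d. Let S := {x ∈ ℝ : g_i(x) ≤ 0 for all i = 1, …, m} be nonempty and let x̄ ∈ S. Then there exist constants c > 0 and ε > 0 such that dist(x, S) ≤ c·( max_{1 ≤ i ≤ m} [g_i(x)]_+ )^{1/d} for all x ∈ ℝ with |x − x̄| ≤ ε. -/
open Metric Set Filter
open scoped BigOperators

noncomputable section

open Polynomial Topology in
/-- To the right of the origin, a real polynomial of degree at most `d` is either nonpositive
or bounded below by a positive multiple of `t ^ d`. -/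
theorem eventually_eval_nonpos_or_exists_mul_pow_le {d : ℕ} (p : Polynomial ℝ)
    (hp : p.natDegree ≤ d) :
    (∀ᶠ t in 𝓝[≥] (0 : ℝ), p.eval t ≤ 0) ∨
      ∃ c > (0 : ℝ), ∀ᶠ t in 𝓝[≥] (0 : ℝ), c * t ^ d ≤ p.eval t := by
  rcases eq_or_ne p 0 with rfl | hp0
  · simp
  obtain ⟨q, hq, hdvd⟩ := exists_eq_pow_rootMultiplicity_mul_and_not_dvd p hp0 0
  have hk : p.rootMultiplicity 0 ≤ d :=
    ((p.count_roots (a := 0)).symm.le.trans (Multiset.count_le_card _ _)).trans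
      (p.card_roots'.trans hp)
  have hq0 : q.eval 0 ≠ 0 := fun h => hdvd (dvd_iff_isRoot.2 h)
  generalize p.rootMultiplicity 0 = k at hq hk
  have heval : ∀ t, p.eval t = t ^ k * q.eval t := fun t => by rw [hq]; simp
  have hnonneg : ∀ᶠ t in 𝓝[≥] (0 : ℝ), 0 ≤ t := self_mem_nhdsWithin
  have hcont : Tendsto (fun t => q.eval t) (𝓝[≥] 0) (𝓝 (q.eval 0)) :=
    q.continuous.continuousAt.tendsto.mono_left nhdsWithin_le_nhds
  rcases hq0.lt_or_gt with h | h
  · left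
    filter_upwards [hnonneg, hcont.eventually_lt_const h] with t ht hqt
    rw [heval]
    exact mul_nonpos_of_nonneg_of_nonpos (pow_nonneg ht k) hqt.le
  · right
    refine ⟨q.eval 0 / 2, half_pos h, ?_⟩
    filter_upwards [hnonneg, hcont.eventually_const_lt (half_lt_self h),
      nhdsWithin_le_nhds (Iio_mem_nhds (zero_lt_one' ℝ))] with t ht hqt ht1
    rw [heval, mul_comm]
    exact mul_le_mul (pow_le_pow_of_le_one ht (le_of_lt ht1) hk) hqt.le (half_pos h).le
      (pow_nonneg ht k)

open Polynomial Topology in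
/-- To the right of the origin, a finite system of polynomial inequalities of degree at most `d`
either holds, or has residual at least a positive multiple of `t ^ d`. -/
theorem exists_eventually_forall_eval_nonpos_or_le_mul_rpow {ι : Type*} [Finite ι] {d : ℕ}
    (hd : d ≠ 0) (p : ι → Polynomial ℝ) (hp : ∀ i, (p i).natDegree ≤ d) :
    ∃ c > (0 : ℝ), ∀ᶠ t in 𝓝[≥] (0 : ℝ), (∀ i, (p i).eval t ≤ 0) ∨
      t ≤ c * (⨆ i, max ((p i).eval t) 0) ^ ((1 : ℝ) / d) := by
  by_cases H : ∀ i, ∀ᶠ t in 𝓝[≥] (0 : ℝ), (p i).eval t ≤ 0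
  · exact ⟨1, one_pos, (eventually_all.2 H).mono fun t ht => Or.inl ht⟩
  obtain ⟨i, hi⟩ := not_forall.1 H
  obtain ⟨c, hc, h⟩ := (eventually_eval_nonpos_or_exists_mul_pow_le (p i) (hp i)).resolve_left hi
  refine ⟨(c⁻¹) ^ ((1 : ℝ) / d), Real.rpow_pos_of_pos (inv_pos.2 hc) _, ?_⟩
  filter_upwards [h, self_mem_nhdsWithin] with t ht ht0
  right
  have hsup : (p i).eval t ≤ ⨆ i, max ((p i).eval t) 0 :=
    (le_max_left _ _).trans
      (le_ciSup (f := fun i => max ((p i).eval t) 0) (Set.finite_range _).bddAbove i)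
  have hpow : t ^ d ≤ c⁻¹ * ⨆ i, max ((p i).eval t) 0 := by
    rw [inv_mul_eq_div, le_div_iff₀' hc]
    exact ht.trans hsup
  rw [← Real.mul_rpow (inv_pos.2 hc).le (Real.iSup_nonneg fun i => le_max_right _ _), one_div]
  calc t = (t ^ d) ^ ((d : ℝ)⁻¹) := (Real.pow_rpow_inv_natCast ht0 hd).symm
    _ ≤ _ := Real.rpow_le_rpow (pow_nonneg ht0 d) hpow (by positivity)

/-- Local error bound with exponent `1/d` for univariate convex polynomial systems
(Remark 3.3 (2)). -/
theorem local_error_bound_univariate_convex_polynomials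
    (m d : ℕ) (hm : 0 < m) (hd : 0 < d)
    (g : Fin m → ℝ → ℝ)
    (hpoly : ∀ i, ∃ p : Polynomial ℝ, p.natDegree ≤ d ∧ ∀ x : ℝ, g i x = p.eval x)
    (hconv : ∀ i, ConvexOn ℝ Set.univ (g i))
    (S : Set ℝ) (hS : S = {x | ∀ i, g i x ≤ 0}) (hSne : S.Nonempty)
    (xbar : ℝ) (hxbar : xbar ∈ S) :
    ∃ c > (0 : ℝ), ∃ ε > (0 : ℝ), ∀ x : ℝ, |x - xbar| ≤ ε →
      Metric.infDist x S ≤ c * (⨆ i, max (g i x) 0) ^ ((1 : ℝ) / d) := by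
  choose p hpd hpe using hpoly
  have side : ∀ s : ℝ, ∃ c > (0 : ℝ), ∀ᶠ t in nhdsWithin (0 : ℝ) (Ici 0), (∀ i, g i (xbar + s * t) ≤ 0) ∨
      t ≤ c * (⨆ i, max (g i (xbar + s * t)) 0) ^ ((1 : ℝ) / d) := by
    intro s
    obtain ⟨c, hc, h⟩ := exists_eventually_forall_eval_nonpos_or_le_mul_rpow hd.ne'
      (fun i => (p i).comp (Polynomial.C xbar + Polynomial.C s * Polynomial.X)) fun i => by
        have hlin : (Polynomial.C xbar + Polynomial.C s * Polynomial.X : Polynomial ℝ).natDegree ≤ 1 := by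
          rw [add_comm]; exact Polynomial.natDegree_linear_le
        exact Polynomial.natDegree_comp_le.trans
          ((Nat.mul_le_mul (hpd i) hlin).trans (mul_one d).le)
    refine ⟨c, hc, ?_⟩
    simpa [hpe] using h
  obtain ⟨c₁, hc₁, h₁⟩ := side 1
  obtain ⟨c₂, hc₂, h₂⟩ := side (-1)
  obtain ⟨ε, hε, hball⟩ :=
    (nhdsGE_basis (0 : ℝ)).eventually_iff.1 (h₁.and h₂)
  refine ⟨max c₁ c₂, lt_max_of_lt_left hc₁, ε / 2, by linarith, fun x hx => ?_⟩
  have hsup : 0 ≤ (⨆ i, max (g i x) 0) ^ ((1 : ℝ) / d) :=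
    Real.rpow_nonneg (Real.iSup_nonneg fun i => le_max_right _ _) _
  have hdist : infDist x S ≤ |x - xbar| := infDist_le_dist_of_mem hxbar
  have key : ∀ c ≤ max c₁ c₂, ((∀ i, g i x ≤ 0) ∨
      |x - xbar| ≤ c * (⨆ i, max (g i x) 0) ^ ((1 : ℝ) / d)) →
      infDist x S ≤ max c₁ c₂ * (⨆ i, max (g i x) 0) ^ ((1 : ℝ) / d) := by
    rintro c hc (h | h)
    · rw [infDist_zero_of_mem (by rw [hS]; exact h)]
      exact mul_nonneg (hc₁.le.trans (le_max_left _ _)) hsup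
    · exact (hdist.trans h).trans (mul_le_mul_of_nonneg_right hc hsup)
  have hmem := hball (x := |x - xbar|) ⟨abs_nonneg _, by linarith⟩
  rcases le_total xbar x with h | h
  · have hx' : xbar + 1 * |x - xbar| = x := by rw [abs_of_nonneg (by linarith)]; ring
    exact key c₁ (le_max_left _ _) (by simpa only [hx'] using hmem.1)
  · have hx' : xbar + -1 * |x - xbar| = x := by rw [abs_of_nonpos (by linarith)]; ring
    exact key c₂ (le_max_right _ _) (by simpa only [hx'] using hmem.2)
end
end
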